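/- arXiv:2407.10117 — 4 statements merged into one kernel-verified Lean document; each statement's English description precedes it below -/
import Mathlib

section
/- For every α ∈ (0,1), ∫_ℝ 𝓟_α(x) log( 𝓟_α(x) / (1−α) ) dx = −(1−α) log( 4(1−α) sin(πα) ) − (1/π) ∫₀^{2πα} log( 2|sin(u/2)| ) du. -/
open MeasureTheory Complex Filter Set
open scoped Real ENNReal Topology

noncomputable section

/-- The Poisson kernel of the strip. -/
def Pker (y x : ℝ) : ℝ :=
  Real.sin (Real.pi * y) / (2 * (Real.cosh (Real.pi * x) - Real.cos (Real.pi * y)))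

lemma aux_int (a b : ℝ) :
    IntervalIntegrable (fun u : ℝ => Real.log (2 * |Real.sin (u / 2)|)) volume a b := by
  have h : MeromorphicOn (fun u : ℝ => 2 * Real.sin (u / 2)) (Set.uIcc a b) := by
    intro x _
    apply AnalyticAt.meromorphicAt
    fun_prop
  have := h.intervalIntegrable_log_norm
  refine this.congr ?_
  intro x _
  simp [abs_mul]

lemma aux_full :
    ∫ u in (0:ℝ)..(2 * Real.pi), Real.log (2 * |Real.sin (u / 2)|) = 0 := by
  have h := intervalIntegral.integral_comp_div
    (fun u : ℝ => Real.log (2 * |Real.sin u|)) (a := 0) (b := 2 * Real.pi) (c := 2) two_ne_zero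
  rw [h]
  have e : (2 * Real.pi / 2) = Real.pi := by ring
  rw [e, zero_div]
  have h2 : ∫ u in (0:ℝ)..Real.pi, Real.log (2 * |Real.sin u|) =
      ∫ u in (0:ℝ)..Real.pi, (Real.log 2 + Real.log (Real.sin u)) := by
    rw [intervalIntegral.integral_of_le Real.pi_pos.le,
      intervalIntegral.integral_of_le Real.pi_pos.le,
      integral_Ioc_eq_integral_Ioo, integral_Ioc_eq_integral_Ioo]
    refine setIntegral_congr_fun measurableSet_Ioo ?_
    intro x hx
    have := Real.sin_pos_of_mem_Ioo hx
    simp only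
    rw [abs_of_pos this, Real.log_mul two_ne_zero this.ne']
  rw [h2, intervalIntegral.integral_add intervalIntegrable_const
    (by apply intervalIntegrable_log_sin), integral_log_sin_zero_pi]
  simp
  ring

lemma aux_compl (t : ℝ) :
    ∫ u in (0:ℝ)..(2 * Real.pi - t), Real.log (2 * |Real.sin (u / 2)|) =
      - ∫ u in (0:ℝ)..t, Real.log (2 * |Real.sin (u / 2)|) := by
  have h1 := intervalIntegral.integral_add_adjacent_intervals
    (aux_int 0 t) (aux_int t (2 * Real.pi))
  rw [aux_full] at h1
  have h2 := intervalIntegral.integral_comp_sub_left (a := t) (b := 2 * Real.pi)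
    (fun u : ℝ => Real.log (2 * |Real.sin (u / 2)|)) (2 * Real.pi)
  rw [sub_self] at h2
  rw [← h2]
  have h3 : ∀ x : ℝ, Real.sin ((2 * Real.pi - x) / 2) = Real.sin (x / 2) := by
    intro x
    rw [show (2 * Real.pi - x) / 2 = Real.pi - x / 2 by ring, Real.sin_pi_sub]
  simp only [h3]
  linarith

/-- the change of variables -/
def phi (θ x : ℝ) : ℝ :=
  2 * Real.arctan (Real.cos (θ / 2) / Real.sin (θ / 2) * Real.tanh (Real.pi * x / 2))

lemma pker_eq (α x : ℝ) : Pker α x =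
    Real.cos (Real.pi * α / 2) * Real.sin (Real.pi * α / 2) /
      (2 * (Real.sin (Real.pi * α / 2) ^ 2 + Real.sinh (Real.pi * x / 2) ^ 2)) := by
  unfold Pker
  have e1 : Real.pi * α = 2 * (Real.pi * α / 2) := by ring
  have e2 : Real.pi * x = 2 * (Real.pi * x / 2) := by ring
  have h1 : Real.sin (Real.pi * α) =
      2 * Real.sin (Real.pi * α / 2) * Real.cos (Real.pi * α / 2) := by
    conv_lhs => rw [e1, Real.sin_two_mul]
  have h2 : Real.cos (Real.pi * α) = 1 - 2 * Real.sin (Real.pi * α / 2) ^ 2 := by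
    conv_lhs => rw [e1, Real.cos_two_mul, Real.cos_sq']
    ring
  have h3 : Real.cosh (Real.pi * x) = 1 + 2 * Real.sinh (Real.pi * x / 2) ^ 2 := by
    conv_lhs => rw [e2, Real.cosh_two_mul, Real.cosh_sq]
    ring
  rw [h1, h2, h3, show 2 * (1 + 2 * Real.sinh (Real.pi * x / 2) ^ 2 -
    (1 - 2 * Real.sin (Real.pi * α / 2) ^ 2)) = 2 * (2 * (Real.sin (Real.pi * α / 2) ^ 2 +
      Real.sinh (Real.pi * x / 2) ^ 2)) by ring, mul_assoc,
      mul_div_mul_left _ _ (two_ne_zero), mul_comm (Real.sin _)]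

lemma phi_deriv (α x : ℝ) (hb : 0 < Real.sin (Real.pi * α / 2)) :
    HasDerivAt (phi (Real.pi * α)) (2 * Real.pi * Pker α x) x := by
  have hc := Real.cosh_pos (Real.pi * x / 2)
  have hcs := Real.cosh_sq (Real.pi * x / 2)
  have hab := Real.sin_sq_add_cos_sq (Real.pi * α / 2)
  have hl : HasDerivAt (fun x : ℝ => Real.pi * x / 2) (Real.pi / 2) x := by
    simpa using ((hasDerivAt_id x).const_mul Real.pi).div_const 2
  have h := ((((hl.sinh).div (hl.cosh) hc.ne').const_mul
    (Real.cos (Real.pi * α / 2) / Real.sin (Real.pi * α / 2))).arctan).const_mul 2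
  have h' : phi (Real.pi * α) = fun x => 2 * Real.arctan (Real.cos (Real.pi * α / 2) /
      Real.sin (Real.pi * α / 2) *
      (Real.sinh (Real.pi * x / 2) / Real.cosh (Real.pi * x / 2))) := by
    funext x
    simp [phi, Real.tanh_eq_sinh_div_cosh]
  rw [h']
  refine h.congr_deriv ?_
  rw [pker_eq]
  simp only [Pi.div_apply]
  set a := Real.cos (Real.pi * α / 2)
  set b := Real.sin (Real.pi * α / 2)
  set c := Real.cosh (Real.pi * x / 2)
  set s := Real.sinh (Real.pi * x / 2)
  have hd : 0 < b ^ 2 + s ^ 2 := by positivity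
  have e1 : 1 + (a / b * (s / c)) ^ 2 = (b ^ 2 + s ^ 2) / (b * c) ^ 2 := by
    field_simp
    linear_combination b ^ 2 * hcs + s ^ 2 * hab
  have e2 : c * (Real.pi / 2) * c - s * (s * (Real.pi / 2)) = Real.pi / 2 := by
    linear_combination (Real.pi / 2) * hcs
  rw [e1, e2]
  field_simp

lemma pker_phi (α x : ℝ) (hb : 0 < Real.sin (Real.pi * α / 2))
    (ha : 0 < Real.cos (Real.pi * α / 2)) :
    4 * Real.sin (Real.pi * α) * Pker α x =
      (2 * Real.sin ((Real.pi - Real.pi * α - phi (Real.pi * α) x) / 2)) *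
      (2 * Real.sin ((Real.pi - Real.pi * α + phi (Real.pi * α) x) / 2)) := by
  have hc := Real.cosh_pos (Real.pi * x / 2)
  have hcs := Real.cosh_sq (Real.pi * x / 2)
  have hab := Real.sin_sq_add_cos_sq (Real.pi * α / 2)
  rw [pker_eq]
  set T := Real.arctan (Real.cos (Real.pi * α / 2) / Real.sin (Real.pi * α / 2) *
    Real.tanh (Real.pi * x / 2)) with hT
  have e1 : (Real.pi - Real.pi * α - phi (Real.pi * α) x) / 2 =
      Real.pi / 2 - (Real.pi * α / 2 + T) := by simp only [phi, hT]; ring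
  have e2 : (Real.pi - Real.pi * α + phi (Real.pi * α) x) / 2 =
      Real.pi / 2 - (Real.pi * α / 2 - T) := by simp only [phi, hT]; ring
  rw [e1, e2, Real.sin_pi_div_two_sub, Real.sin_pi_div_two_sub, Real.cos_add, Real.cos_sub]
  have e3 : Real.sin (Real.pi * α) =
      2 * Real.sin (Real.pi * α / 2) * Real.cos (Real.pi * α / 2) := by
    rw [← Real.sin_two_mul]; congr 1; ring
  rw [e3]
  have h1 := Real.cos_sq_arctan (Real.cos (Real.pi * α / 2) / Real.sin (Real.pi * α / 2) *
    Real.tanh (Real.pi * x / 2))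
  rw [← hT, Real.tanh_eq_sinh_div_cosh] at h1
  have h2 := Real.sin_sq_add_cos_sq T
  set a := Real.cos (Real.pi * α / 2)
  set b := Real.sin (Real.pi * α / 2)
  set c := Real.cosh (Real.pi * x / 2)
  set s := Real.sinh (Real.pi * x / 2)
  have hd : 0 < b ^ 2 + s ^ 2 := by positivity
  have e1 : 1 + (a / b * (s / c)) ^ 2 = (b ^ 2 + s ^ 2) / (b * c) ^ 2 := by
    field_simp
    linear_combination b ^ 2 * hcs + s ^ 2 * hab
  rw [e1] at h1
  have h3 : Real.cos T ^ 2 * (b ^ 2 + s ^ 2) = (b * c) ^ 2 := by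
    rw [h1]; field_simp
  have : (2 * (a * Real.cos T - b * Real.sin T)) * (2 * (a * Real.cos T + b * Real.sin T)) =
      4 * (Real.cos T ^ 2 - b ^ 2) := by
    linear_combination (4 * Real.cos T ^ 2) * hab - 4 * b ^ 2 * h2
  rw [this]
  rw [mul_div_assoc', div_eq_iff (by positivity)]
  linear_combination (-8) * h3 + 8 * b ^ 2 * hab - 8 * b ^ 2 * hcs

lemma phi_inj (α : ℝ) (hb : 0 < Real.sin (Real.pi * α / 2))
    (ha : 0 < Real.cos (Real.pi * α / 2)) : Function.Injective (phi (Real.pi * α)) := by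
  intro x y h
  unfold phi at h
  have h1 := Real.arctan_injective (mul_left_cancel₀ two_ne_zero h)
  have h2 := Real.tanh_injective (mul_left_cancel₀ (div_pos ha hb).ne' h1)
  have := Real.pi_pos
  have h3 : Real.pi * x = Real.pi * y := by linarith
  exact mul_left_cancel₀ this.ne' h3

lemma phi_image (α : ℝ) (hα : α ∈ Set.Ioo (0:ℝ) 1) (hb : 0 < Real.sin (Real.pi * α / 2))
    (ha : 0 < Real.cos (Real.pi * α / 2)) :
    phi (Real.pi * α) '' Set.univ =
      Set.Ioo (-(Real.pi - Real.pi * α)) (Real.pi - Real.pi * α) := by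
  have hpi := Real.pi_pos
  have hp : 0 < Real.pi * α := mul_pos hpi hα.1
  have hp2 : Real.pi * α < Real.pi := by nlinarith [hα.2]
  set k := Real.cos (Real.pi * α / 2) / Real.sin (Real.pi * α / 2) with hk
  have hk0 : 0 < k := div_pos ha hb
  have hat : Real.arctan k = (Real.pi - Real.pi * α) / 2 := by
    rw [show (Real.pi - Real.pi * α) / 2 = Real.pi / 2 - Real.pi * α / 2 by ring,
      ← Real.arctan_tan (x := Real.pi / 2 - Real.pi * α / 2) (by linarith) (by linarith),
      Real.tan_pi_div_two_sub, Real.tan_eq_sin_div_cos, inv_div]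
  ext y
  simp only [Set.image_univ, Set.mem_range, Set.mem_Ioo]
  constructor
  · rintro ⟨x, rfl⟩
    have h1 := Real.tanh_lt_one (Real.pi * x / 2)
    have h2 := Real.neg_one_lt_tanh (Real.pi * x / 2)
    have h3 := Real.arctan_strictMono (show k * Real.tanh (Real.pi * x / 2) < k by nlinarith)
    have h4 := Real.arctan_strictMono (show -k < k * Real.tanh (Real.pi * x / 2) by nlinarith)
    rw [Real.arctan_neg] at h4
    rw [hat] at h3 h4
    simp only [phi, ← hk]
    constructor <;> linarith
  · rintro ⟨h1, h2⟩
    have hy1 : Real.tan (y / 2) < k := by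
      rw [← Real.tan_arctan k]
      apply Real.tan_lt_tan_of_lt_of_lt_pi_div_two <;> linarith
    have hy2 : -k < Real.tan (y / 2) := by
      rw [← Real.tan_arctan k, ← Real.tan_neg]
      apply Real.tan_lt_tan_of_lt_of_lt_pi_div_two <;> linarith
    refine ⟨2 * Real.artanh (Real.tan (y / 2) / k) / Real.pi, ?_⟩
    simp only [phi, ← hk]
    rw [show Real.pi * (2 * Real.artanh (Real.tan (y / 2) / k) / Real.pi) / 2 =
      Real.artanh (Real.tan (y / 2) / k) by field_simp, Real.tanh_artanh,
      mul_div_cancel₀ _ hk0.ne', Real.arctan_tan (by linarith) (by linarith)]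
    · ring
    · constructor
      · rw [lt_div_iff₀ hk0]; linarith
      · rw [div_lt_iff₀ hk0]; linarith

/-- **Analytic formula** (Remark 1.4 / Appendix C): evaluation of the Poisson-entropy
integral in terms of the Clausen integral. -/
theorem poisson_entropy_integral (α : ℝ) (hα : α ∈ Set.Ioo (0:ℝ) 1) :
    (∫ x : ℝ, Pker α x * Real.log (Pker α x / (1 - α))) =
      -(1 - α) * Real.log (4 * (1 - α) * Real.sin (Real.pi * α)) -
        (1 / Real.pi) * ∫ u in (0:ℝ)..(2 * Real.pi * α), Real.log (2 * |Real.sin (u / 2)|) := by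
  have hpi := Real.pi_pos
  have hp : 0 < Real.pi * α := mul_pos hpi hα.1
  have hp2 : Real.pi * α < Real.pi := by nlinarith [hα.2]
  have hα1 : 0 < 1 - α := by linarith [hα.2]
  have hb : 0 < Real.sin (Real.pi * α / 2) :=
    Real.sin_pos_of_pos_of_lt_pi (by linarith) (by linarith)
  have ha : 0 < Real.cos (Real.pi * α / 2) :=
    Real.cos_pos_of_mem_Ioo ⟨by linarith, by linarith⟩
  have hs : 0 < Real.sin (Real.pi * α) := Real.sin_pos_of_pos_of_lt_pi hp hp2
  set F : ℝ → ℝ := fun u => Real.log (2 * |Real.sin (u / 2)|) with hF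
  set β := Real.pi - Real.pi * α with hβ
  set L := Real.log (4 * (1 - α) * Real.sin (Real.pi * α)) with hL
  have hPpos : ∀ x, 0 < Pker α x := by
    intro x
    rw [pker_eq]
    positivity
  have key := integral_image_eq_integral_abs_deriv_smul (s := Set.univ)
    (f := phi (Real.pi * α)) (f' := fun x => 2 * Real.pi * Pker α x) MeasurableSet.univ
    (fun x _ => (phi_deriv α x hb).hasDerivWithinAt) (phi_inj α hb ha).injOn
    (fun t => (1 / (2 * Real.pi)) * (F (β - t) + F (β + t) - L))
  rw [phi_image α hα hb ha, Measure.restrict_univ] at key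
  have hpt : ∀ x, |2 * Real.pi * Pker α x| • ((1 / (2 * Real.pi)) *
      (F (β - phi (Real.pi * α) x) + F (β + phi (Real.pi * α) x) - L)) =
      Pker α x * Real.log (Pker α x / (1 - α)) := by
    intro x
    have hP := hPpos x
    rw [abs_of_pos (by positivity), smul_eq_mul]
    have h1 := pker_phi α x hb ha
    rw [← hβ] at h1
    have h2 : Pker α x / (1 - α) = (4 * Real.sin (Real.pi * α) * Pker α x) /
        (4 * (1 - α) * Real.sin (Real.pi * α)) := by
      rw [div_eq_div_iff (by positivity) (by positivity)]
      ring
    have hne : 4 * Real.sin (Real.pi * α) * Pker α x ≠ 0 := by positivity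
    rw [h2, Real.log_div hne (by positivity), ← hL, h1]
    rw [h1] at hne
    rw [Real.log_mul (left_ne_zero_of_mul hne) (right_ne_zero_of_mul hne),
      ← Real.log_abs (2 * Real.sin ((β - _) / 2)), ← Real.log_abs (2 * Real.sin ((β + _) / 2)),
      abs_mul, abs_mul, abs_two]
    simp only [hF]
    field_simp
  simp only [hpt] at key
  rw [← key, ← integral_Ioc_eq_integral_Ioo, ← intervalIntegral.integral_of_le (by linarith),
    intervalIntegral.integral_const_mul]
  have hFi : ∀ a b, IntervalIntegrable F volume a b := aux_int
  have hi1 : IntervalIntegrable (fun t => F (β - t)) volume (-β) β := by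
    have := (hFi (β + β) 0).comp_sub_left β
    simpa using this
  have hi2 : IntervalIntegrable (fun t => F (β + t)) volume (-β) β := by
    have := (hFi 0 (β + β)).comp_add_left β
    simpa using this
  rw [intervalIntegral.integral_sub (hi1.add hi2) intervalIntegrable_const,
    intervalIntegral.integral_add hi1 hi2, intervalIntegral.integral_comp_sub_left,
    intervalIntegral.integral_comp_add_left, intervalIntegral.integral_const]
  have hc := aux_compl (2 * Real.pi * α)
  rw [show 2 * Real.pi - 2 * Real.pi * α = β + β by rw [hβ]; ring] at hc
  rw [show β - -β = β + β by ring, sub_self, add_neg_cancel, hc, smul_eq_mul]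
  have : β = Real.pi * (1 - α) := by rw [hβ]; ring
  rw [this]
  field_simp
  ring
end
end

section
/- Let 1 ≤ p, q ≤ ∞. There exists a constant C > 0 depending only on p and q such that every h ∈ H^{p,q}(S) satisfies |h(x + iy)| ≤ C · ‖h‖_{H^{p,q}} · ( y^{−1/p} + (1−y)^{−1/q} ) for all x ∈ ℝ and 0 < y < 1 (with the convention y^{−1/∞} = 1). -/
open MeasureTheory Complex Filter Set
open scoped Real ENNReal Topology

noncomputable section

def Strip : Set ℂ := {z : ℂ | 0 < z.im ∧ z.im < 1}

def bLine (h : ℂ → ℂ) (y : ℝ) : ℝ → ℂ := fun x => h (x + y * Complex.I)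

def hardyNorm (p q : ℝ≥0∞) (h : ℂ → ℂ) : ℝ≥0∞ :=
  ⨆ y ∈ Set.Ioo (0:ℝ) 1,
    ⨅ (f : ℝ → ℂ) (g : ℝ → ℂ) (_ : Measurable f) (_ : Measurable g)
      (_ : f + g = bLine h y),
      ENNReal.ofReal (1 - y)⁻¹ * eLpNorm f p volume +
        ENNReal.ofReal y⁻¹ * eLpNorm g q volume

def MemHardy (p q : ℝ≥0∞) (h : ℂ → ℂ) : Prop :=
  DifferentiableOn ℂ h Strip ∧ hardyNorm p q h < ⊤

def IsTrace0 (h : ℂ → ℂ) (v : ℝ → ℂ) : Prop :=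
  ∀ φ : SchwartzMap ℝ ℂ,
    Tendsto (fun y : ℝ => ∫ x : ℝ, h (x + y * Complex.I) * (starRingEnd ℂ) (φ x))
      (𝓝[>] (0:ℝ)) (𝓝 (∫ x : ℝ, v x * (starRingEnd ℂ) (φ x)))

def IsTrace1 (h : ℂ → ℂ) (w : ℝ → ℂ) : Prop :=
  ∀ φ : SchwartzMap ℝ ℂ,
    Tendsto (fun y : ℝ => ∫ x : ℝ, h (x + y * Complex.I) * (starRingEnd ℂ) (φ x))
      (𝓝[<] (1:ℝ)) (𝓝 (∫ x : ℝ, w x * (starRingEnd ℂ) (φ x)))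

lemma ue_circle (h : ℂ → ℂ) (c : ℂ) (r ρ : ℝ) (hρ : 0 < ρ) (hr : ρ < r)
    (hd : DifferentiableOn ℂ h (Metric.ball c r)) :
    ENNReal.ofReal (2 * π) * ‖h c‖ₑ ≤
      ∫⁻ θ in Ioo (-π) π, ‖h (circleMap c ρ θ)‖ₑ := by
  have h1 : DiffContOnCl ℂ h (Metric.ball c |ρ|) := by
    apply DifferentiableOn.diffContOnCl
    apply hd.mono
    rw [abs_of_pos hρ, closure_ball c hρ.ne']
    exact Metric.closedBall_subset_ball hr
  have h2 := h1.circleAverage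
  rw [Real.circleAverage_eq_integral_add (-π),
    intervalIntegral.integral_comp_add_right (fun θ ↦ h (circleMap c ρ θ))] at h2
  have e1 : (0:ℝ) + -π = -π := by ring
  have e2 : 2 * π + -π = π := by ring
  rw [e1, e2, intervalIntegral.integral_of_le (by linarith [Real.pi_pos]),
    integral_Ioc_eq_integral_Ioo] at h2
  have h3 : (2 * π) • h c = ∫ θ in Ioo (-π) π, h (circleMap c ρ θ) := by
    rw [← h2, smul_smul, mul_inv_cancel₀ (by positivity), one_smul]
  have h4 : ENNReal.ofReal (2 * π) * ‖h c‖ₑ = ‖(2 * π) • h c‖ₑ := by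
    rw [enorm_smul, Real.enorm_of_nonneg (by positivity)]
  rw [h4, h3]
  exact enorm_integral_le_lintegral_enorm _

lemma ue_rad (r : ℝ) (hr : 0 < r) :
    ∫⁻ ρ in Ioo 0 r, ENNReal.ofReal ρ = ENNReal.ofReal (r ^ 2 / 2) := by
  rw [← ofReal_integral_eq_lintegral_ofReal]
  · rw [← integral_Ioc_eq_integral_Ioo, ← intervalIntegral.integral_of_le hr.le, integral_id]
    simp
  · exact (continuous_id.integrableOn_Icc (a := 0) (b := r)).mono_set Ioo_subset_Icc_self
  · filter_upwards [ae_restrict_mem measurableSet_Ioo] with x hx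
    exact hx.1.le

lemma ue_mean (h : ℂ → ℂ) (c : ℂ) (r : ℝ) (hr : 0 < r)
    (hd : DifferentiableOn ℂ h (Metric.ball c r)) :
    ENNReal.ofReal (π * r ^ 2) * ‖h c‖ₑ ≤ ∫⁻ w in Metric.ball c r, ‖h w‖ₑ := by
  set F : ℂ → ℝ≥0∞ := (Metric.ball c r).indicator (fun w => ‖h w‖ₑ) with hF
  have hFm : Measurable F := by
    classical
    have hc : ContinuousOn (fun w => ‖h w‖ₑ) (Metric.ball c r) := hd.continuousOn.enorm
    have := hc.measurable_piecewise (g := fun _ => (0:ℝ≥0∞)) continuousOn_const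
      Metric.isOpen_ball.measurableSet
    rwa [hF, ← Set.piecewise_eq_indicator]
  rw [← lintegral_indicator Metric.isOpen_ball.measurableSet]
  change _ ≤ ∫⁻ w, F w
  rw [← lintegral_add_left_eq_self F c, ← Complex.lintegral_comp_polarCoord_symm]
  have hm : Measurable (fun p : ℝ × ℝ =>
      ENNReal.ofReal p.1 • F (c + Complex.polarCoord.symm p)) := by
    simp only [Complex.polarCoord_symm_apply, smul_eq_mul]
    apply Measurable.mul (by fun_prop)
    apply hFm.comp
    apply Continuous.measurable
    fun_prop
  have ht : _root_.polarCoord.target = Ioi (0:ℝ) ×ˢ Ioo (-π) π := rfl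
  rw [ht, Measure.volume_eq_prod, setLIntegral_prod _ hm.aemeasurable]
  calc ENNReal.ofReal (π * r ^ 2) * ‖h c‖ₑ
      = ∫⁻ ρ in Ioo 0 r, ENNReal.ofReal ρ * (ENNReal.ofReal (2 * π) * ‖h c‖ₑ) := by
        rw [lintegral_mul_const _ (by fun_prop), ue_rad r hr, ← mul_assoc,
          ← ENNReal.ofReal_mul (by positivity)]
        congr 2; ring
    _ ≤ ∫⁻ ρ in Ioo 0 r, ∫⁻ θ in Ioo (-π) π,
          ENNReal.ofReal ρ • F (c + Complex.polarCoord.symm (ρ, θ)) := by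
        apply setLIntegral_mono' measurableSet_Ioo
        intro ρ hρ
        have hcm : ∀ θ : ℝ, c + Complex.polarCoord.symm (ρ, θ) = circleMap c ρ θ := by
          intro θ
          simp [circleMap, Complex.exp_mul_I]
        have : ∀ θ : ℝ, F (c + Complex.polarCoord.symm (ρ, θ)) = ‖h (circleMap c ρ θ)‖ₑ := by
          intro θ
          rw [hcm, hF, indicator_of_mem]
          rw [Metric.mem_ball, Metric.mem_sphere.1 (circleMap_mem_sphere c hρ.1.le θ)]
          exact hρ.2
        simp only [this, smul_eq_mul]
        rw [lintegral_const_mul' _ _ ENNReal.ofReal_ne_top]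
        gcongr
        exact ue_circle h c r ρ hρ.1 hρ.2 hd
    _ ≤ _ := lintegral_mono_set (fun x hx => hx.1)

lemma ue_holder (f : ℝ → ℂ) (hf : Measurable f) (p : ℝ≥0∞) (hp : 1 ≤ p) (x r : ℝ) (hr : 0 < r) :
    ∫⁻ t in Ioo (x - r) (x + r), ‖f t‖ₑ ≤
      ENNReal.ofReal ((2 * r) ^ (1 - (p⁻¹).toReal)) * eLpNorm f p volume := by
  have h1 := eLpNorm_le_eLpNorm_mul_rpow_measure_univ (μ := volume.restrict (Ioo (x - r) (x + r)))
    hp hf.aestronglyMeasurable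
  rw [eLpNorm_one_eq_lintegral_enorm] at h1
  refine h1.trans ?_
  rw [mul_comm]
  have e : x + r - (x - r) = 2 * r := by ring
  simp only [Measure.restrict_apply_univ, Real.volume_Ioo, e, ENNReal.toReal_one, div_one, one_div]
  rw [ENNReal.ofReal_rpow_of_pos (by positivity), ENNReal.toReal_inv]
  gcongr
  exact Measure.restrict_le_self

lemma ue_line (p q : ℝ≥0∞) (hp : 1 ≤ p) (hq : 1 ≤ q) (h : ℂ → ℂ) (x r η M : ℝ) (hr : 0 < r)
    (hη : η ∈ Ioo (0:ℝ) 1) (hM : 0 < M)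
    (h1 : (1 - η) * (2 * r) ^ (1 - (p⁻¹).toReal) ≤ M)
    (h2 : η * (2 * r) ^ (1 - (q⁻¹).toReal) ≤ M) :
    ∫⁻ t in Ioo (x - r) (x + r), ‖h (t + η * Complex.I)‖ₑ ≤
      ENNReal.ofReal M * hardyNorm p q h := by
  have hM0 : ENNReal.ofReal M ≠ 0 := by simpa using hM
  rw [mul_comm (ENNReal.ofReal M), ← ENNReal.div_le_iff hM0 ENNReal.ofReal_ne_top]
  have key : ∀ (s N : ℝ) (a : ℝ≥0∞), 0 < s → s * N ≤ M →
      ENNReal.ofReal N * a ≤ ENNReal.ofReal M * (ENNReal.ofReal s⁻¹ * a) := by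
    intro s N a hs hN
    rw [← mul_assoc, ← ENNReal.ofReal_mul hM.le]
    gcongr
    rw [← div_eq_mul_inv, le_div_iff₀ hs, mul_comm]
    exact hN
  refine le_trans ?_ (le_iSup₂ (f := fun (y : ℝ) (_ : y ∈ Set.Ioo (0:ℝ) 1) =>
    ⨅ (f : ℝ → ℂ) (g : ℝ → ℂ) (_ : Measurable f) (_ : Measurable g)
      (_ : f + g = bLine h y),
      ENNReal.ofReal (1 - y)⁻¹ * eLpNorm f p volume +
        ENNReal.ofReal y⁻¹ * eLpNorm g q volume) η hη)
  refine le_iInf fun f => le_iInf fun g => le_iInf fun hf => le_iInf fun hg => le_iInf fun hfg => ?_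
  rw [ENNReal.div_le_iff hM0 ENNReal.ofReal_ne_top, mul_comm _ (ENNReal.ofReal M)]
  calc ∫⁻ t in Ioo (x - r) (x + r), ‖h (t + η * Complex.I)‖ₑ
      ≤ ∫⁻ t in Ioo (x - r) (x + r), (‖f t‖ₑ + ‖g t‖ₑ) := by
        apply lintegral_mono
        intro t
        have : h (t + η * Complex.I) = f t + g t := (congrFun hfg t).symm
        simp only [this]
        exact enorm_add_le _ _
    _ = (∫⁻ t in Ioo (x - r) (x + r), ‖f t‖ₑ) + ∫⁻ t in Ioo (x - r) (x + r), ‖g t‖ₑ :=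
        lintegral_add_left hf.enorm _
    _ ≤ _ := add_le_add (ue_holder f hf p hp x r hr) (ue_holder g hg q hq x r hr)
    _ ≤ _ := by
        rw [mul_add]
        exact add_le_add (key _ _ _ (by linarith [hη.2]) h1) (key _ _ _ hη.1 h2)

lemma ue_main (p q : ℝ≥0∞) (hp : 1 ≤ p) (hq : 1 ≤ q) (h : ℂ → ℂ) (hh : MemHardy p q h)
    (x y r M : ℝ) (hr : 0 < r) (hry : r ≤ y) (hry1 : y + r ≤ 1) (hM : 0 < M)
    (h1 : ∀ η ∈ Ioo (y - r) (y + r), (1 - η) * (2 * r) ^ (1 - (p⁻¹).toReal) ≤ M)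
    (h2 : ∀ η ∈ Ioo (y - r) (y + r), η * (2 * r) ^ (1 - (q⁻¹).toReal) ≤ M) :
    π * r ^ 2 * ‖h (x + y * Complex.I)‖ ≤ 2 * r * M * (hardyNorm p q h).toReal := by
  set c : ℂ := x + y * Complex.I with hc
  have hcre : c.re = x := by simp [hc]
  have hcim : c.im = y := by simp [hc]
  have hstrip : Metric.ball c r ⊆ Strip := by
    intro w hw
    rw [Metric.mem_ball, dist_eq] at hw
    have := (abs_im_le_norm (w - c)).trans_lt hw
    rw [sub_im, hcim, abs_lt] at this
    exact ⟨by linarith, by linarith⟩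
  have hd := hh.1.mono hstrip
  set R : Set (ℝ × ℝ) := Ioo (x - r) (x + r) ×ˢ Ioo (y - r) (y + r) with hR
  set F : ℂ → ℝ≥0∞ := (Metric.ball c r).indicator (fun w => ‖h w‖ₑ) with hF
  have hFm : Measurable F := by
    classical
    have hc : ContinuousOn (fun w => ‖h w‖ₑ) (Metric.ball c r) := hd.continuousOn.enorm
    have := hc.measurable_piecewise (g := fun _ => (0:ℝ≥0∞)) continuousOn_const
      Metric.isOpen_ball.measurableSet
    rwa [hF, ← Set.piecewise_eq_indicator]
  have hA : ∫⁻ w in Metric.ball c r, ‖h w‖ₑ ≤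
      ENNReal.ofReal (2 * r) * (ENNReal.ofReal M * hardyNorm p q h) := by
    rw [← lintegral_indicator Metric.isOpen_ball.measurableSet]
    change ∫⁻ w, F w ≤ _
    rw [← (volume_preserving_equiv_real_prod.symm).lintegral_comp_emb
      measurableEquivRealProd.symm.measurableEmbedding]
    have hs : ∀ z : ℝ × ℝ, F (measurableEquivRealProd.symm z) =
        R.indicator (fun z => F (measurableEquivRealProd.symm z)) z := by
      intro z
      by_cases hz : z ∈ R
      · rw [indicator_of_mem hz]
      · rw [indicator_of_notMem hz, hF, indicator_of_notMem]
        contrapose! hz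
        rw [Metric.mem_ball, dist_eq] at hz
        have a1 := (abs_im_le_norm _).trans_lt hz
        have a2 := (abs_re_le_norm _).trans_lt hz
        rw [sub_im, hcim, abs_lt] at a1
        rw [sub_re, hcre, abs_lt] at a2
        simp only [measurableEquivRealProd_symm_apply] at a1 a2
        exact ⟨⟨by linarith, by linarith⟩, ⟨by linarith, by linarith⟩⟩
    have hFm2 : Measurable (fun z : ℝ × ℝ => F (measurableEquivRealProd.symm z)) :=
      hFm.comp (MeasurableEquiv.measurable _)
    rw [lintegral_congr hs, lintegral_indicator (measurableSet_Ioo.prod measurableSet_Ioo),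
      Measure.volume_eq_prod, setLIntegral_prod_symm _ hFm2.aemeasurable]
    calc ∫⁻ η in Ioo (y - r) (y + r), ∫⁻ t in Ioo (x - r) (x + r),
          F (measurableEquivRealProd.symm (t, η))
        ≤ ∫⁻ η in Ioo (y - r) (y + r), ENNReal.ofReal M * hardyNorm p q h := by
          apply setLIntegral_mono' measurableSet_Ioo
          intro η hη
          refine le_trans (lintegral_mono fun t => ?_) (ue_line p q hp hq h x r η M hr
            ⟨by linarith [hη.1], by linarith [hη.2]⟩ hM (h1 η hη) (h2 η hη))
          have e : measurableEquivRealProd.symm (t, η) = t + η * Complex.I := by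
            rw [measurableEquivRealProd_symm_apply]; exact mk_eq_add_mul_I t η
          rw [← e]
          exact indicator_le_self _ _ _
      _ = _ := by
          rw [setLIntegral_const, Real.volume_Ioo, mul_comm]
          congr 2; ring
  have hB := (ue_mean h c r hr hd).trans hA
  have hfin : ENNReal.ofReal (2 * r) * (ENNReal.ofReal M * hardyNorm p q h) ≠ ⊤ :=
    ENNReal.mul_ne_top ENNReal.ofReal_ne_top (ENNReal.mul_ne_top ENNReal.ofReal_ne_top hh.2.ne)
  have hC := ENNReal.toReal_mono hfin hB
  rw [ENNReal.toReal_mul, ENNReal.toReal_mul, ENNReal.toReal_mul, toReal_enorm,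
    ENNReal.toReal_ofReal (by positivity), ENNReal.toReal_ofReal (by positivity),
    ENNReal.toReal_ofReal hM.le, ← mul_assoc] at hC
  exact hC

lemma ue_exp (p : ℝ≥0∞) (hp : 1 ≤ p) : 0 ≤ (p⁻¹).toReal ∧ (p⁻¹).toReal ≤ 1 := by
  refine ⟨ENNReal.toReal_nonneg, ?_⟩
  have := ENNReal.toReal_mono ENNReal.one_ne_top (ENNReal.inv_le_one.2 hp)
  simpa using this

/-- arithmetic with `s = 2r` -/
lemma ue_arith (s a b η : ℝ) (hs : 0 < s) (hs1 : s ≤ 1) (ha : 0 ≤ a) (hb : b ≤ 1)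
    (hη : η ≤ 3 / 2 * s) : η * s ^ (1 - b) ≤ 3 / 2 * s ^ (1 - a) := by
  have h1 : s ^ (1 - b) ≤ 1 := Real.rpow_le_one hs.le hs1 (by linarith)
  have h2 : s ≤ s ^ (1 - a) := by
    have := Real.rpow_le_rpow_of_exponent_ge hs hs1 (show 1 - a ≤ 1 by linarith)
    simpa using this
  have h3 : 0 < s ^ (1 - b) := Real.rpow_pos_of_pos hs _
  nlinarith

lemma ue_fin (s a H N : ℝ) (hs : 0 < s) (hH : 0 ≤ H) (_hN : 0 ≤ N)
    (h : π * (s / 2) ^ 2 * H ≤ 2 * (s / 2) * (3 / 2 * s ^ (1 - a)) * N) :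
    H ≤ 2 * N * s ^ (-a) := by
  have e : s ^ (1 - a) = s * s ^ (-a) := by
    rw [sub_eq_add_neg, Real.rpow_add hs, Real.rpow_one]
  rw [e] at h
  have h3 : 0 < s ^ (-a) := Real.rpow_pos_of_pos hs _
  have hpi := Real.pi_gt_three
  have h4 : s ^ 2 * (π * H) ≤ s ^ 2 * (6 * N * s ^ (-a)) := by nlinarith
  have h5 := le_of_mul_le_mul_left h4 (by positivity)
  nlinarith

/-- **Uniform estimate** (Lemma 2.5): a pointwise bound on `H^{p,q}` functions,
uniform away from the boundary of the strip. -/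
theorem uniform_estimate (p q : ℝ≥0∞) (hp : 1 ≤ p) (hq : 1 ≤ q) :
    ∃ C : ℝ, 0 < C ∧ ∀ h : ℂ → ℂ, MemHardy p q h → ∀ x y : ℝ, y ∈ Set.Ioo (0:ℝ) 1 →
      ‖h (x + y * Complex.I)‖ ≤
        C * (hardyNorm p q h).toReal *
          (y ^ (-(p⁻¹).toReal) + (1 - y) ^ (-(q⁻¹).toReal)) := by
  obtain ⟨ha0, ha1⟩ := ue_exp p hp
  obtain ⟨hb0, hb1⟩ := ue_exp q hq
  refine ⟨2, by norm_num, ?_⟩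
  intro h hh x y ⟨hy0, hy1⟩
  have hN : 0 ≤ (hardyNorm p q h).toReal := ENNReal.toReal_nonneg
  have hy1' : 0 < 1 - y := by linarith
  have P1 : 0 < y ^ (-(p⁻¹).toReal) := Real.rpow_pos_of_pos hy0 _
  have P2 : 0 < (1 - y) ^ (-(q⁻¹).toReal) := Real.rpow_pos_of_pos hy1' _
  rcases le_total y (1 / 2) with hy | hy
  · have e : 2 * (y / 2) = y := by ring
    have P3 : 0 < y ^ (1 - (p⁻¹).toReal) := Real.rpow_pos_of_pos hy0 _
    have := ue_main p q hp hq h hh x y (y / 2) (3 / 2 * y ^ (1 - (p⁻¹).toReal)) (by linarith)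
      (by linarith) (by linarith) (by positivity)
      (by intro η hη; rw [e]; nlinarith [hη.1])
      (by intro η hη; rw [e]; exact ue_arith y _ _ η hy0 hy1.le ha0 hb1 (by linarith [hη.2]))
    have := ue_fin y _ _ _ hy0 (norm_nonneg _) hN this
    refine this.trans ?_
    gcongr
    linarith
  · have e : 2 * ((1 - y) / 2) = 1 - y := by ring
    have P3 : 0 < (1 - y) ^ (1 - (q⁻¹).toReal) := Real.rpow_pos_of_pos hy1' _
    have := ue_main p q hp hq h hh x y ((1 - y) / 2) (3 / 2 * (1 - y) ^ (1 - (q⁻¹).toReal))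
      (by linarith) (by linarith) (by linarith) (by positivity)
      (by
        intro η hη; rw [e]
        exact ue_arith (1 - y) _ _ (1 - η) hy1' (by linarith) hb0 ha1 (by linarith [hη.1]))
      (by intro η hη; rw [e]; nlinarith [hη.2])
    have := ue_fin (1 - y) _ _ _ hy1' (norm_nonneg _) hN this
    refine this.trans ?_
    gcongr
    linarith
end
end

section
/- Let 1 ≤ p, q ≤ ∞ with Hölder conjugates p*, q*. If h ∈ H^{p,q}(S) and m ∈ H^{p*,q*}(S), then the pointwise product F(z) := m(z) h(z) belongs to H^{1,1}(S), the classical Hardy space H¹ of the strip. -/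
open MeasureTheory Complex Filter Set
open scoped Real ENNReal Topology

noncomputable section

lemma isOpen_Strip : IsOpen Strip :=
  (isOpen_lt continuous_const Complex.continuous_im).inter
    (isOpen_lt Complex.continuous_im continuous_const)

lemma circle_mean (h : ℂ → ℂ) (c : ℂ) (r ρ : ℝ) (hρ : 0 < ρ) (hρr : ρ < r)
    (hd : DifferentiableOn ℂ h (Metric.ball c r)) :
    ENNReal.ofReal (2 * π) * ‖h c‖ₑ ≤
      ∫⁻ θ in Ioo (-π) π, ‖h (c + ρ * (Real.cos θ + Real.sin θ * I))‖ₑ := by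
  have hcl : Metric.closedBall c ρ ⊆ Metric.ball c r := Metric.closedBall_subset_ball hρr
  have hdc : DiffContOnCl ℂ h (Metric.ball c |ρ|) := by
    rw [abs_of_pos hρ]
    apply DifferentiableOn.diffContOnCl
    exact hd.mono (Metric.closure_ball_subset_closedBall.trans hcl)
  have h1 := hdc.circleAverage
  rw [Real.circleAverage_def] at h1
  have hper : Function.Periodic (fun θ => h (circleMap c ρ θ)) (2 * π) := by
    intro θ; simp [periodic_circleMap c ρ θ]
  have h2 := hper.intervalIntegral_add_eq 0 (-π)
  rw [zero_add, show -π + 2 * π = π by ring] at h2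
  rw [h2] at h1
  have h3 : ‖(∫ θ in (-π)..π, h (circleMap c ρ θ))‖ₑ = ENNReal.ofReal (2 * π) * ‖h c‖ₑ := by
    rw [← h1, enorm_smul, ← mul_assoc, Real.enorm_eq_ofReal (by positivity),
      ← ENNReal.ofReal_mul (by positivity), mul_inv_cancel₀ (by positivity)]
    simp
  rw [← h3, intervalIntegral.integral_of_le (by linarith [Real.pi_pos]),
    integral_Ioc_eq_integral_Ioo]
  refine (enorm_integral_le_lintegral_enorm _).trans (le_of_eq ?_)
  congr 1 with θ
  rw [circleMap, Complex.exp_mul_I]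
  simp

lemma area_mean (h : ℂ → ℂ) (c : ℂ) (r : ℝ) (hr : 0 < r)
    (hd : DifferentiableOn ℂ h (Metric.ball c r)) :
    ENNReal.ofReal (r ^ 2) * ‖h c‖ₑ ≤ ∫⁻ z in Metric.ball c r, ‖h z‖ₑ := by
  set u : ℂ → ℝ≥0∞ := (Metric.ball c r).indicator (fun z => ‖h z‖ₑ) with hu
  have hum : Measurable u := by
    have h1 : ContinuousOn (fun z => ‖h z‖ₑ) (Metric.ball c r) := hd.continuousOn.enorm
    classical
    rw [hu, ← piecewise_eq_indicator]
    exact h1.measurable_piecewise continuousOn_const Metric.isOpen_ball.measurableSet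
  have htar : polarCoord.target = Ioi (0:ℝ) ×ˢ Ioo (-π) π := rfl
  rw [← lintegral_indicator Metric.isOpen_ball.measurableSet, ← hu,
    ← lintegral_add_left_eq_self u c, ← Complex.lintegral_comp_polarCoord_symm,
    htar, Measure.volume_eq_prod, ← Measure.prod_restrict,
    lintegral_prod]
  swap
  · apply Measurable.aemeasurable
    simp only [smul_eq_mul, Complex.polarCoord_symm_apply]
    refine Measurable.mul (by fun_prop) (hum.comp (by fun_prop))
  calc ENNReal.ofReal (r ^ 2) * ‖h c‖ₑ 
      ≤ ∫⁻ ρ in Ioo (r/2) r, ENNReal.ofReal (r/2) * (ENNReal.ofReal (2 * π) * ‖h c‖ₑ) := by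
        rw [setLIntegral_const, Real.volume_Ioo, show r - r / 2 = r / 2 by ring, mul_right_comm, ← mul_assoc,
          ← ENNReal.ofReal_mul (by positivity), ← ENNReal.ofReal_mul (by positivity)]
        gcongr
        nlinarith [Real.pi_gt_three, sq_nonneg r]
    _ ≤ ∫⁻ ρ in Ioo (r/2) r, ∫⁻ θ in Ioo (-π) π,
          ENNReal.ofReal ρ • u (c + Complex.polarCoord.symm (ρ, θ)) := by
        refine setLIntegral_mono' measurableSet_Ioo fun ρ hρ => ?_
        simp only [smul_eq_mul]
        rw [lintegral_const_mul' _ _ ENNReal.ofReal_ne_top]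
        gcongr
        · exact hρ.1.le
        · refine (circle_mean h c r ρ (by linarith [hρ.1]) hρ.2 hd).trans (le_of_eq ?_)
          congr 1 with θ
          rw [Complex.polarCoord_symm_apply, hu, indicator_of_mem]
          have h5 := Complex.norm_polarCoord_symm (ρ, θ)
          rw [Complex.polarCoord_symm_apply] at h5
          simp only [Metric.mem_ball, dist_self_add_left]
          rw [h5, abs_of_pos (by linarith [hρ.1])]
          exact hρ.2
    _ ≤ _ := by
        apply lintegral_mono_set
        intro ρ hρ
        exact lt_trans (by positivity) hρ.1

def Dec (p q : ℝ≥0∞) (h : ℂ → ℂ) (N : ℝ) : Prop :=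
  ∀ y ∈ Ioo (0:ℝ) 1, ∃ E : Set ℝ, MeasurableSet E ∧
    eLpNorm (E.indicator (bLine h y)) p volume ≤ ENNReal.ofReal (N * (1 - y)) ∧
    eLpNorm (Eᶜ.indicator (bLine h y)) q volume ≤ ENNReal.ofReal (N * y)

lemma mem_Strip_aux {x y : ℝ} (hy : y ∈ Ioo (0:ℝ) 1) : (x + y * I : ℂ) ∈ Strip := by
  simpa [Strip] using hy

lemma bLine_continuous {h : ℂ → ℂ} (hd : DifferentiableOn ℂ h Strip) {y : ℝ}
    (hy : y ∈ Ioo (0:ℝ) 1) : Continuous (bLine h y) :=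
  hd.continuousOn.comp_continuous (by fun_prop) fun _ => mem_Strip_aux hy

lemma exists_Dec {p q : ℝ≥0∞} {h : ℂ → ℂ} (hh : MemHardy p q h) :
    ∃ N : ℝ, 1 ≤ N ∧ Dec p q h N := by
  obtain ⟨hd, hN⟩ := hh
  set K := (hardyNorm p q h).toReal + 1 with hK
  have hK1 : 1 ≤ K := by rw [hK]; linarith [ENNReal.toReal_nonneg (a := hardyNorm p q h)]
  refine ⟨2 * K, by linarith, fun y hy => ?_⟩
  have h1 : (⨅ (f : ℝ → ℂ) (g : ℝ → ℂ) (_ : Measurable f) (_ : Measurable g)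
      (_ : f + g = bLine h y),
      ENNReal.ofReal (1 - y)⁻¹ * eLpNorm f p volume +
        ENNReal.ofReal y⁻¹ * eLpNorm g q volume) < ENNReal.ofReal K := by
    refine lt_of_le_of_lt (le_iSup₂ (α := ℝ≥0∞) (f := fun (y : ℝ) (_ : y ∈ Ioo (0:ℝ) 1) =>
      (⨅ (f : ℝ → ℂ) (g : ℝ → ℂ) (_ : Measurable f) (_ : Measurable g)
      (_ : f + g = bLine h y),
      ENNReal.ofReal (1 - y)⁻¹ * eLpNorm f p volume +
        ENNReal.ofReal y⁻¹ * eLpNorm g q volume)) y hy) ?_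
    change hardyNorm p q h < _
    rw [hK, ENNReal.lt_ofReal_iff_toReal_lt hN.ne]
    linarith
  simp only [iInf_lt_iff] at h1
  obtain ⟨f, g, hf, hg, hfg, hlt⟩ := h1
  have hb : Measurable (bLine h y) := (bLine_continuous hd hy).measurable
  have key : ∀ (t : ℝ) (a : ℝ≥0∞), 0 < t → ENNReal.ofReal t⁻¹ * a ≤ ENNReal.ofReal K →
      2 * a ≤ ENNReal.ofReal (2 * K * t) := by
    intro t a ht hle
    calc 2 * a = ENNReal.ofReal (2 * t) * (ENNReal.ofReal t⁻¹ * a) := by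
          rw [← mul_assoc, ← ENNReal.ofReal_mul (by positivity), mul_assoc,
            mul_inv_cancel₀ ht.ne']; simp
      _ ≤ ENNReal.ofReal (2 * t) * ENNReal.ofReal K := by gcongr
      _ = _ := by rw [← ENNReal.ofReal_mul (by positivity)]; ring_nf
  refine ⟨{x | ‖g x‖ ≤ ‖f x‖}, measurableSet_le hg.norm hf.norm, ?_, ?_⟩
  · refine le_trans ?_ (key (1 - y) (eLpNorm f p volume) (by linarith [hy.2])
      (le_self_add.trans hlt.le))
    have := eLpNorm_le_nnreal_smul_eLpNorm_of_ae_le_mul (c := 2) (p := p) (μ := volume)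
      (f := ({x | ‖g x‖ ≤ ‖f x‖}).indicator (bLine h y)) (g := f) ?_
    · simpa [ENNReal.smul_def] using this
    refine .of_forall fun x => ?_
    by_cases hx : ‖g x‖ ≤ ‖f x‖
    · rw [indicator_of_mem (by exact hx), ← hfg]
      have : ‖f x + g x‖ ≤ 2 * ‖f x‖ := (norm_add_le _ _).trans (by linarith)
      exact_mod_cast this
    · rw [indicator_of_notMem (by exact hx)]; simp
  · refine le_trans ?_ (key y (eLpNorm g q volume) hy.1 (le_add_self.trans hlt.le))
    have := eLpNorm_le_nnreal_smul_eLpNorm_of_ae_le_mul (c := 2) (p := q) (μ := volume)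
      (f := ({x | ‖g x‖ ≤ ‖f x‖}ᶜ).indicator (bLine h y)) (g := g) ?_
    · simpa [ENNReal.smul_def] using this
    refine .of_forall fun x => ?_
    by_cases hx : ‖g x‖ ≤ ‖f x‖
    · rw [indicator_of_notMem (by simpa using hx)]; simp
    · rw [indicator_of_mem (by simpa using hx), ← hfg]
      have : ‖f x + g x‖ ≤ 2 * ‖g x‖ := (norm_add_le _ _).trans (by linarith)
      exact_mod_cast this

lemma setL1_le {p : ℝ≥0∞} (hp : 1 ≤ p) {f : ℝ → ℂ} (hf : AEStronglyMeasurable f volume)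
    (x r : ℝ) (hr : 0 < r) :
    ∫⁻ t in Ioo (x - r) (x + r), ‖f t‖ₑ ≤
      eLpNorm f p volume * ENNReal.ofReal ((2 * r) ^ (1 - p⁻¹.toReal)) := by
  have h1 := eLpNorm_le_eLpNorm_mul_rpow_measure_univ (μ := volume.restrict (Ioo (x-r) (x+r))) hp
    (f := f) hf.restrict
  rw [eLpNorm_one_eq_lintegral_enorm] at h1
  refine h1.trans ?_
  gcongr ?_ * ?_
  · exact eLpNorm_restrict_le _ _ _ _
  · rw [Measure.restrict_apply_univ, Real.volume_Ioo, show x + r - (x - r) = 2 * r by ring,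
      ENNReal.ofReal_rpow_of_pos (by positivity)]
    simp

lemma line_L1_le {p q : ℝ≥0∞} (hp : 1 ≤ p) (hq : 1 ≤ q) {h : ℂ → ℂ} {N : ℝ} (hN : 1 ≤ N)
    (hd : DifferentiableOn ℂ h Strip) (hD : Dec p q h N) (x y r Y : ℝ) (hr : 0 < r)
    (hy : y ∈ Ioo (0:ℝ) 1) (hY : y ≤ Y) :
    ∫⁻ t in Ioo (x - r) (x + r), ‖bLine h y t‖ₑ ≤
      ENNReal.ofReal (N * ((2 * r) ^ (1 - p⁻¹.toReal) + Y * (2 * r) ^ (1 - q⁻¹.toReal))) := by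
  obtain ⟨E, hE, h1, h2⟩ := hD y hy
  have hb : Measurable (bLine h y) := (bLine_continuous hd hy).measurable
  have hY0 : 0 < Y := hy.1.trans_le hY
  calc ∫⁻ t in Ioo (x - r) (x + r), ‖bLine h y t‖ₑ
      ≤ ∫⁻ t in Ioo (x - r) (x + r), (‖E.indicator (bLine h y) t‖ₑ
          + ‖Eᶜ.indicator (bLine h y) t‖ₑ) := by
        refine lintegral_mono fun t => ?_
        by_cases ht : t ∈ E <;> simp [ht]
    _ ≤ ENNReal.ofReal N * ENNReal.ofReal ((2 * r) ^ (1 - p⁻¹.toReal)) +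
         ENNReal.ofReal (N * Y) * ENNReal.ofReal ((2 * r) ^ (1 - q⁻¹.toReal)) := by
        rw [lintegral_add_left (by exact (hb.indicator hE).enorm)]
        gcongr
        · refine (setL1_le hp (hb.indicator hE).aestronglyMeasurable x r hr).trans ?_
          gcongr
          refine h1.trans (ENNReal.ofReal_le_ofReal ?_)
          nlinarith [hy.1]
        · refine (setL1_le hq (hb.indicator hE.compl).aestronglyMeasurable x r hr).trans ?_
          gcongr
          refine h2.trans (ENNReal.ofReal_le_ofReal ?_)
          nlinarith [hy.1]
    _ = _ := by
        rw [← ENNReal.ofReal_mul (by positivity), ← ENNReal.ofReal_mul (by positivity),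
          ← ENNReal.ofReal_add (by positivity) (by positivity)]
        congr 1; ring

lemma pointwise {p q : ℝ≥0∞} (hp : 1 ≤ p) (hq : 1 ≤ q) {h : ℂ → ℂ} {N : ℝ} (hN : 1 ≤ N)
    (hd : DifferentiableOn ℂ h Strip) (hD : Dec p q h N) (z : ℂ) (r : ℝ) (hr : 0 < r)
    (hr1 : r < z.im) (hr2 : z.im + r < 1) :
    ‖h z‖ ≤ 4 * N * ((2 * r) ^ (-p⁻¹.toReal) + (z.im + r) * (2 * r) ^ (-q⁻¹.toReal)) := by
  set A := N * ((2 * r) ^ (1 - p⁻¹.toReal) + (z.im + r) * (2 * r) ^ (1 - q⁻¹.toReal)) with hA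
  have hA0 : 0 ≤ A := by
    have : 0 ≤ z.im + r := by linarith
    positivity
  have hsub : Metric.ball z r ⊆ Strip := by
    intro w hw
    rw [Metric.mem_ball, dist_eq_norm] at hw
    have := (Complex.abs_im_le_norm (w - z)).trans_lt hw
    rw [Complex.sub_im, abs_lt] at this
    exact ⟨by linarith, by linarith⟩
  have h1 := area_mean h z r hr (hd.mono hsub)
  have h2 : ∫⁻ w in Metric.ball z r, ‖h w‖ₑ ≤ ENNReal.ofReal (2 * r * A) := by
    set R : Set (ℝ × ℝ) := Ioo (z.re - r) (z.re + r) ×ˢ Ioo (z.im - r) (z.im + r) with hR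
    have hRm : MeasurableSet R := measurableSet_Ioo.prod measurableSet_Ioo
    calc ∫⁻ w in Metric.ball z r, ‖h w‖ₑ
        ≤ ∫⁻ w in Complex.measurableEquivRealProd ⁻¹' R, ‖h w‖ₑ := by
          apply lintegral_mono_set
          intro w hw
          rw [Metric.mem_ball, dist_eq_norm] at hw
          have e1 := (Complex.abs_im_le_norm (w - z)).trans_lt hw
          have e2 := (Complex.abs_re_le_norm (w - z)).trans_lt hw
          rw [Complex.sub_im, abs_lt] at e1
          rw [Complex.sub_re, abs_lt] at e2
          simp only [hR, mem_preimage, Complex.measurableEquivRealProd_apply, mem_prod, mem_Ioo]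
          refine ⟨⟨?_, ?_⟩, ?_, ?_⟩ <;> linarith
      _ = ∫⁻ v in R, ‖h (v.1 + v.2 * I)‖ₑ := by
          rw [← Complex.volume_preserving_equiv_real_prod.setLIntegral_comp_preimage_emb
            Complex.measurableEquivRealProd.measurableEmbedding]
          congr 1 with w
          simp
      _ = ∫⁻ y in Ioo (z.im - r) (z.im + r), ∫⁻ x in Ioo (z.re - r) (z.re + r),
            ‖bLine h y x‖ₑ := by
          rw [hR, Measure.volume_eq_prod, ← Measure.prod_restrict, lintegral_prod_symm]
          · rfl
          rw [Measure.prod_restrict]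
          refine ContinuousOn.aemeasurable ?_ hRm
          apply ContinuousOn.enorm
          refine hd.continuousOn.comp (by fun_prop) ?_
          rintro ⟨a, b⟩ hab
          apply mem_Strip_aux
          simp only [mem_prod, mem_Ioo] at hab
          constructor <;> linarith
      _ ≤ ∫⁻ y in Ioo (z.im - r) (z.im + r), ENNReal.ofReal A := by
          refine setLIntegral_mono' measurableSet_Ioo fun y hy => ?_
          exact line_L1_le hp hq hN hd hD _ y r _ hr ⟨by linarith [hy.1], by linarith [hy.2]⟩ hy.2.le
      _ = _ := by
          rw [setLIntegral_const, Real.volume_Ioo, ← ENNReal.ofReal_mul hA0]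
          congr 1; ring
  have h3 := h1.trans h2
  rw [← ofReal_norm, ← ENNReal.ofReal_mul (by positivity),
    ENNReal.ofReal_le_ofReal_iff (by positivity)] at h3
  have e : ∀ a : ℝ, (2 * r) ^ (1 - a) = 2 * r * (2 * r) ^ (-a) := by
    intro a
    rw [sub_eq_add_neg, Real.rpow_add (by positivity), Real.rpow_one]
  rw [hA, e, e] at h3
  have : r ^ 2 * ‖h z‖ ≤ r ^ 2 * (4 * N * ((2 * r) ^ (-p⁻¹.toReal) +
    (z.im + r) * (2 * r) ^ (-q⁻¹.toReal))) := by
    refine h3.trans (le_of_eq ?_); ring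
  exact le_of_mul_le_mul_left this (by positivity)

lemma inv_toReal_mem {p : ℝ≥0∞} (hp : 1 ≤ p) : 0 ≤ p⁻¹.toReal ∧ p⁻¹.toReal ≤ 1 := by
  refine ⟨ENNReal.toReal_nonneg, ?_⟩
  have : p⁻¹ ≤ 1 := ENNReal.inv_le_one.2 hp
  simpa using ENNReal.toReal_mono (by simp) this

lemma pointwise_low {p q : ℝ≥0∞} (hp : 1 ≤ p) (hq : 1 ≤ q) {h : ℂ → ℂ} {N : ℝ} (hN : 1 ≤ N)
    (hd : DifferentiableOn ℂ h Strip) (hD : Dec p q h N) (z : ℂ) (h0 : 0 < z.im)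
    (h1 : z.im < 1 / 2) :
    ‖h z‖ ≤ 10 * N * z.im ^ (-p⁻¹.toReal) := by
  have h2 := pointwise hp hq hN hd hD z (z.im / 2) (by linarith) (by linarith) (by linarith)
  rw [show 2 * (z.im / 2) = z.im by ring] at h2
  refine h2.trans ?_
  obtain ⟨ha0, ha1⟩ := inv_toReal_mem hp
  obtain ⟨hb0, hb1⟩ := inv_toReal_mem hq
  have e1 : z.im * z.im ^ (-q⁻¹.toReal) ≤ 1 := by
    calc z.im * z.im ^ (-q⁻¹.toReal) = z.im ^ (1 - q⁻¹.toReal) := by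
          rw [sub_eq_add_neg, Real.rpow_add h0, Real.rpow_one]
      _ ≤ 1 := Real.rpow_le_one h0.le (by linarith) (by linarith)
  have e2 : 1 ≤ z.im ^ (-p⁻¹.toReal) :=
    Real.one_le_rpow_of_pos_of_le_one_of_nonpos h0 (by linarith) (by linarith)
  have : z.im ^ (-p⁻¹.toReal) + (z.im + z.im / 2) * z.im ^ (-q⁻¹.toReal) ≤
    5 / 2 * z.im ^ (-p⁻¹.toReal) := by nlinarith
  nlinarith

lemma bounded_sub {p q : ℝ≥0∞} (hp : 1 ≤ p) (hq : 1 ≤ q) {h : ℂ → ℂ} {N : ℝ} (hN : 1 ≤ N)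
    (hd : DifferentiableOn ℂ h Strip) (hD : Dec p q h N) (α β : ℝ) (h0 : 0 < α) (h1 : β < 1) :
    ∃ B : ℝ, 0 ≤ B ∧ ∀ z : ℂ, α ≤ z.im → z.im ≤ β → ‖h z‖ ≤ B := by
  set r := min α (1 - β) / 2 with hr
  have hm : 0 < min α (1 - β) := lt_min h0 (by linarith)
  have hr0 : 0 < r := by positivity
  have hr1 : r < α := by have := min_le_left α (1 - β); rw [hr]; linarith
  have hr2 : r < 1 - β := by have := min_le_right α (1 - β); rw [hr]; linarith
  refine ⟨4 * N * ((2 * r) ^ (-p⁻¹.toReal) + 1 * (2 * r) ^ (-q⁻¹.toReal)), by positivity,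
    fun z hz1 hz2 => ?_⟩
  refine (pointwise hp hq hN hd hD z r hr0 (by linarith) (by linarith)).trans ?_
  gcongr
  linarith

def LocBdd (Φ : ℂ → ℂ) : Prop := ∀ α β : ℝ, 0 < α → β < 1 →
    ∃ B : ℝ, 0 ≤ B ∧ ∀ z : ℂ, α ≤ z.im → z.im ≤ β → ‖Φ z‖ ≤ B

lemma conv_diff {Φ : ℂ → ℂ} (hd : DifferentiableOn ℂ Φ Strip) (hb : LocBdd Φ)
    (s : ℝ → ℂ) (hs : Measurable s) (hs1 : ∀ t, ‖s t‖ ≤ 1) (R : ℝ) :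
    DifferentiableOn ℂ (fun z => ∫ t in Ioo (-R) R, Φ (z + t) * s t) Strip := by
  intro z hz
  apply DifferentiableAt.differentiableWithinAt
  obtain ⟨hz0, hz1⟩ := hz
  set r := min z.im (1 - z.im) / 4 with hr
  have hm : 0 < min z.im (1 - z.im) := lt_min hz0 (by linarith)
  have hr0 : 0 < r := by positivity
  have hr1 : 4 * r ≤ z.im := by have := min_le_left z.im (1 - z.im); rw [hr]; linarith
  have hr2 : 4 * r ≤ 1 - z.im := by have := min_le_right z.im (1 - z.im); rw [hr]; linarith
  obtain ⟨B, hB0, hB⟩ := hb (z.im - 2 * r) (z.im + 2 * r) (by linarith) (by linarith)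
  have him : ∀ w ∈ Metric.ball z r, ∀ t : ℝ, z.im - r ≤ (w + t).im ∧ (w + t).im ≤ z.im + r := by
    intro w hw t
    rw [Metric.mem_ball, dist_eq_norm] at hw
    have e1 := (Complex.abs_im_le_norm (w - z)).trans_lt hw
    rw [Complex.sub_im, abs_lt] at e1
    simp only [Complex.add_im, Complex.ofReal_im, add_zero]
    constructor <;> linarith
  have hS : ∀ w ∈ Metric.ball z r, ∀ t : ℝ, w + t ∈ Strip := by
    intro w hw t
    have := him w hw t
    exact ⟨by linarith, by linarith⟩
  have hzb : z ∈ Metric.ball z r := Metric.mem_ball_self hr0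
  have hc : ∀ w ∈ Metric.ball z r, Continuous fun t : ℝ => Φ (w + t) := fun w hw =>
    hd.continuousOn.comp_continuous (by fun_prop) (hS w hw)
  have hdc : Continuous fun t : ℝ => deriv Φ (z + t) :=
    (hd.deriv isOpen_Strip).continuousOn.comp_continuous (by fun_prop) (hS z hzb)
  have := hasDerivAt_integral_of_dominated_loc_of_deriv_le (𝕜 := ℂ)
    (μ := volume.restrict (Ioo (-R) R)) (F := fun z t => Φ (z + t) * s t)
    (F' := fun z t => deriv Φ (z + t) * s t) (x₀ := z) (s := Metric.ball z r)
    (bound := fun _ => B / r)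
    (Metric.ball_mem_nhds z hr0) ?_ ?_ ?_ ?_ ?_ ?_
  · exact this.2.differentiableAt
  · filter_upwards [Metric.ball_mem_nhds z hr0] with w hw
    exact ((hc w hw).measurable.mul hs).aestronglyMeasurable
  · refine Integrable.mono' (g := fun _ => B) (integrable_const _)
      ((hc z hzb).measurable.mul hs).aestronglyMeasurable (.of_forall fun t => ?_)
    rw [norm_mul]
    have := him z hzb t
    have h1 := hB (z + t) (by linarith) (by linarith)
    calc ‖Φ (z + t)‖ * ‖s t‖ ≤ B * 1 := by gcongr; exact hs1 t
      _ = B := mul_one B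
  · exact (hdc.measurable.mul hs).aestronglyMeasurable
  · refine .of_forall fun t w hw => ?_
    rw [norm_mul]
    have h1 : ‖deriv Φ (w + t)‖ ≤ B / r := by
      apply Complex.norm_deriv_le_of_forall_mem_sphere_norm_le hr0
      · apply DifferentiableOn.diffContOnCl
        apply hd.mono
        refine Metric.closure_ball_subset_closedBall.trans ?_
        intro v hv
        rw [Metric.mem_closedBall, dist_eq_norm] at hv
        have e1 := (Complex.abs_im_le_norm _).trans hv
        rw [Complex.sub_im, abs_le] at e1
        have := him w hw t
        exact ⟨by linarith, by linarith⟩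
      · intro v hv
        rw [mem_sphere_iff_norm] at hv
        have e1 := (Complex.abs_im_le_norm _).trans hv.le
        rw [Complex.sub_im, abs_le] at e1
        have := him w hw t
        exact hB v (by linarith) (by linarith)
    calc ‖deriv Φ (w + t)‖ * ‖s t‖ ≤ B / r * 1 := by gcongr; exact hs1 t
      _ = B / r := mul_one _
  · exact integrable_const _
  · refine .of_forall fun t w hw => ?_
    apply HasDerivAt.mul_const
    have := (hd.differentiableAt (isOpen_Strip.mem_nhds (hS w hw t))).hasDerivAt
    exact this.comp_add_const w (t : ℂ)

lemma three_lines {Φ : ℂ → ℂ} (hd : DifferentiableOn ℂ Φ Strip) (hb : LocBdd Φ)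
    (α β y C : ℝ) (h0 : 0 < α) (hαy : α < y) (hyβ : y < β) (h1 : β < 1) (hC : 0 ≤ C)
    (hα : ∫⁻ x, ‖bLine Φ α x‖ₑ ≤ ENNReal.ofReal C)
    (hβ : ∫⁻ x, ‖bLine Φ β x‖ₑ ≤ ENNReal.ofReal C) :
    ∫⁻ x, ‖bLine Φ y x‖ₑ ≤ ENNReal.ofReal C := by
  have hy : y ∈ Ioo (0:ℝ) 1 := ⟨by linarith, by linarith⟩
  have hyc := bLine_continuous hd hy
  -- truncated version
  have key : ∀ R : ℝ, ∫⁻ x in Ioo (-R) R, ‖bLine Φ y x‖ₑ ≤ ENNReal.ofReal C := by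
    intro R
    set s : ℝ → ℂ := fun t => (starRingEnd ℂ) (bLine Φ y t) / ‖bLine Φ y t‖ with hs
    have hsm : Measurable s := by
      have := hyc.measurable
      have h2 : Measurable (fun t => (starRingEnd ℂ) (bLine Φ y t)) :=
        Complex.continuous_conj.measurable.comp this
      exact h2.div (by fun_prop)
    have hs1 : ∀ t, ‖s t‖ ≤ 1 := by
      intro t
      simp only [hs, norm_div, RCLike.norm_conj, Complex.norm_real, norm_norm]
      exact div_self_le_one _
    set G : ℂ → ℂ := fun z => ∫ t in Ioo (-R) R, Φ (z + t) * s t with hG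
    have hGd : DifferentiableOn ℂ G Strip := conv_diff hd hb s hsm hs1 R
    have hbd : ∀ δ : ℝ, (∫⁻ x, ‖bLine Φ δ x‖ₑ ≤ ENNReal.ofReal C) → 
        ∀ z : ℂ, z.im = δ → ‖G z‖ ≤ C := by
      intro δ hδ z hz
      rw [← ENNReal.ofReal_le_ofReal_iff hC, ofReal_norm]
      calc ‖G z‖ₑ ≤ ∫⁻ t in Ioo (-R) R, ‖Φ (z + t) * s t‖ₑ := enorm_integral_le_lintegral_enorm _
        _ ≤ ∫⁻ t : ℝ, ‖Φ (z + t) * s t‖ₑ := setLIntegral_le_lintegral _ _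
        _ ≤ ∫⁻ t : ℝ, ‖bLine Φ δ (t + z.re)‖ₑ := by
            refine lintegral_mono fun t => ?_
            rw [enorm_mul]
            have e1 : ‖s t‖ₑ ≤ 1 := by
              rw [← ofReal_norm]; exact ENNReal.ofReal_le_one.2 (hs1 t)
            have e2 : Φ (z + t) = bLine Φ δ (t + z.re) := by
              rw [bLine, ← hz]
              congr 1
              apply Complex.ext <;> simp [add_comm]
            rw [e2]
            calc _ ≤ ‖bLine Φ δ (t + z.re)‖ₑ * 1 := by gcongr
              _ = _ := mul_one _
        _ = ∫⁻ t : ℝ, ‖bLine Φ δ t‖ₑ :=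
            lintegral_add_right_eq_self (fun t => ‖bLine Φ δ t‖ₑ) z.re
        _ ≤ _ := hδ
    obtain ⟨B, hB0, hB⟩ := hb α β h0 h1
    have hmain : ‖G (y * I)‖ ≤ C := by
      refine PhragmenLindelof.horizontal_strip (a := α) (b := β) ?_ ?_ (hbd α hα) (hbd β hβ)
        (by simpa using hαy.le) (by simpa using hyβ.le)
      · apply DifferentiableOn.diffContOnCl
        apply hGd.mono
        rw [Complex.closure_preimage_im, closure_Ioo (by linarith)]
        intro w hw
        exact ⟨by linarith [hw.1], by linarith [hw.2]⟩
      · refine ⟨0, by apply div_pos Real.pi_pos; linarith, 0, ?_⟩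
        simp only [zero_mul, Real.exp_zero]
        apply Asymptotics.IsBigO.of_bound (B * (volume.real (Ioo (-R) R)))
        apply Filter.eventually_inf_principal.2
        refine .of_forall fun w hw => ?_
        have : ‖G w‖ ≤ B * volume.real (Ioo (-R) R) := by
          apply norm_setIntegral_le_of_norm_le_const (by simp)
          intro t _
          rw [norm_mul]
          have h3 : ‖Φ (w + t)‖ ≤ B := hB _ (by simpa using hw.1.le) (by simpa using hw.2.le)
          calc _ ≤ B * 1 := by gcongr; exact hs1 t
            _ = B := mul_one B
        simpa using this
    have hGy : G (y * I) = ((∫ t in Ioo (-R) R, ‖bLine Φ y t‖ : ℝ) : ℂ) := by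
      rw [← integral_complex_ofReal, hG]
      refine integral_congr_ae (.of_forall fun t => ?_)
      beta_reduce
      have e2 : Φ (y * I + t) = bLine Φ y t := by rw [bLine, add_comm]
      simp only [e2, hs]
      by_cases h0 : bLine Φ y t = 0
      · simp [h0]
      · rw [← mul_div_assoc, Complex.mul_conj, Complex.normSq_eq_norm_sq]
        have : (‖bLine Φ y t‖ : ℂ) ≠ 0 := by exact_mod_cast norm_ne_zero_iff.2 h0
        push_cast
        field_simp
    rw [hGy, Complex.norm_real, Real.norm_of_nonneg (by positivity)] at hmain
    rw [← ofReal_integral_norm_eq_lintegral_enorm]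
    · exact ENNReal.ofReal_le_ofReal hmain
    · exact (hyc.integrableOn_Icc (a := -R) (b := R)).mono_set Ioo_subset_Icc_self
  have hU : (⋃ n : ℕ, Ioo (-(n:ℝ)) n) = univ := by
    ext x
    simp only [mem_iUnion, mem_univ, iff_true, mem_Ioo]
    obtain ⟨n, hn⟩ := exists_nat_gt |x|
    exact ⟨n, abs_lt.1 hn⟩
  rw [← setLIntegral_univ, ← hU, setLIntegral_iUnion_of_directed]
  · exact iSup_le fun n => key n
  · refine Monotone.directed_le fun a b hab => ?_
    apply Ioo_subset_Ioo <;> simpa using hab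

lemma holder1 {p pst : ℝ≥0∞} (hpc : p⁻¹ + pst⁻¹ = 1) {f g : ℝ → ℂ} (hf : Measurable f)
    (hg : Measurable g) :
    ∫⁻ x, ‖f x‖ₑ * ‖g x‖ₑ ≤ eLpNorm f p volume * eLpNorm g pst volume := by
  have : ENNReal.HolderTriple p pst 1 := ⟨by simpa using hpc⟩
  have := eLpNorm_smul_le_mul_eLpNorm (p := p) (q := pst) (r := 1) (μ := volume)
    hg.aestronglyMeasurable hf.aestronglyMeasurable
  rw [eLpNorm_one_eq_lintegral_enorm] at this
  simpa [enorm_mul] using this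

lemma interp {p q : ℝ≥0∞} (hp : 1 ≤ p) (hpq : p ≤ q) {f : ℝ → ℂ} {N δ : ℝ} (hN : 1 ≤ N)
    (hδ : 0 < δ) (h1 : eLpNorm f p volume ≤ ENNReal.ofReal N)
    (h2 : ∀ x, ‖f x‖ ≤ N * δ ^ (-p⁻¹.toReal)) :
    eLpNorm f q volume ≤ ENNReal.ofReal (N * δ ^ (-(p⁻¹.toReal - q⁻¹.toReal))) := by
  by_cases hq : q = ⊤
  · subst hq
    rw [eLpNorm_exponent_top]
    refine (eLpNormEssSup_le_of_ae_bound (.of_forall h2)).trans ?_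
    simp
  have hp' : p ≠ ⊤ := fun h => hq (top_le_iff.1 (h ▸ hpq))
  have hp0 : p ≠ 0 := (one_pos.trans_le hp).ne'
  have hq0 : q ≠ 0 := (one_pos.trans_le (hp.trans hpq)).ne'
  set P := p.toReal with hP
  set Q := q.toReal with hQ
  have hP0 : 0 < P := ENNReal.toReal_pos hp0 hp'
  have hQ0 : 0 < Q := ENNReal.toReal_pos hq0 hq
  have hPQ : P ≤ Q := ENNReal.toReal_mono hq hpq
  rw [ENNReal.toReal_inv, ENNReal.toReal_inv, ← hP, ← hQ]
  rw [ENNReal.toReal_inv, ← hP] at h2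
  rw [eLpNorm_eq_lintegral_rpow_enorm_toReal hp0 hp', ← hP, one_div,
    ENNReal.rpow_inv_le_iff hP0] at h1
  rw [eLpNorm_eq_lintegral_rpow_enorm_toReal hq0 hq, ← hQ, one_div, ENNReal.rpow_inv_le_iff hQ0]
  have hN0 : 0 < N := by linarith
  set M := N * δ ^ (-P⁻¹) with hM
  have hM0 : 0 < M := by positivity
  calc ∫⁻ x, ‖f x‖ₑ ^ Q ≤ ∫⁻ x, ENNReal.ofReal M ^ (Q - P) * ‖f x‖ₑ ^ P := by
        refine lintegral_mono fun x => ?_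
        calc ‖f x‖ₑ ^ Q = ‖f x‖ₑ ^ (Q - P) * ‖f x‖ₑ ^ P := by
              rw [← ENNReal.rpow_add_of_nonneg _ _ (by linarith) hP0.le, sub_add_cancel]
          _ ≤ _ := by
              gcongr ?_ * _
              refine ENNReal.rpow_le_rpow ?_ (by linarith)
              rw [← ofReal_norm]; exact ENNReal.ofReal_le_ofReal (h2 x)
    _ = ENNReal.ofReal M ^ (Q - P) * ∫⁻ x, ‖f x‖ₑ ^ P := by
        rw [lintegral_const_mul']
        exact ENNReal.rpow_ne_top_of_nonneg (by linarith) ENNReal.ofReal_ne_top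
    _ ≤ ENNReal.ofReal M ^ (Q - P) * ENNReal.ofReal N ^ P := by gcongr
    _ = _ := by
        rw [ENNReal.ofReal_rpow_of_pos hM0, ENNReal.ofReal_rpow_of_pos hN0,
          ENNReal.ofReal_rpow_of_pos (by positivity), ← ENNReal.ofReal_mul (by positivity)]
        congr 1
        rw [hM, Real.mul_rpow (by positivity) (by positivity),
          Real.mul_rpow (by positivity) (by positivity), ← Real.rpow_mul hδ.le,
          ← Real.rpow_mul hδ.le, mul_right_comm, ← Real.rpow_add hN0, sub_add_cancel]
        congr 2
        field_simp

lemma gauss_memLp {s : ℝ≥0∞} (hs : s ≠ 0) {ε : ℝ} (hε : 0 < ε) :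
    eLpNorm (fun x : ℝ => ((Real.exp (-ε * x ^ 2) : ℝ) : ℂ)) s volume < ⊤ := by
  by_cases ht : s = ⊤
  · subst ht
    rw [eLpNorm_exponent_top]
    refine (eLpNormEssSup_le_of_ae_bound (C := 1) (.of_forall fun x => ?_)).trans_lt (by simp)
    rw [Complex.norm_real, Real.norm_of_nonneg (by positivity), Real.exp_le_one_iff]
    nlinarith [sq_nonneg x]
  have hS : 0 < s.toReal := ENNReal.toReal_pos hs ht
  rw [eLpNorm_lt_top_iff_lintegral_rpow_enorm_lt_top hs ht]
  have h1 := (integrable_exp_neg_mul_sq (b := ε * s.toReal) (by positivity)).lintegral_lt_top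
  refine lt_of_le_of_lt (le_of_eq ?_) h1
  congr 1 with x
  rw [← ofReal_norm, Complex.norm_real, Real.norm_of_nonneg (by positivity),
    ENNReal.ofReal_rpow_of_pos (by positivity), ← Real.exp_mul]
  congr 2; ring

lemma gauss_le_one {ε : ℝ} (hε : 0 < ε) (x : ℝ) : ENNReal.ofReal (Real.exp (-ε * x ^ 2)) ≤ 1 := by
  rw [ENNReal.ofReal_le_one, Real.exp_le_one_iff]
  nlinarith [sq_nonneg x]

lemma cross {p q qst : ℝ≥0∞} (hp : 1 ≤ p) (hq : 1 ≤ q) (hqc : q⁻¹ + qst⁻¹ = 1) {N : ℝ}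
    (hN : 1 ≤ N) {ε : ℝ} (hε : 0 < ε) : ∀ᶠ δ in 𝓝[>] (0:ℝ), ∀ f g : ℝ → ℂ, Measurable f →
      Measurable g → eLpNorm f p volume ≤ ENNReal.ofReal N →
      (∀ x, ‖f x‖ ≤ N * δ ^ (-p⁻¹.toReal)) → eLpNorm g qst volume ≤ ENNReal.ofReal (N * δ) →
      ∫⁻ x, ‖f x‖ₑ * ‖g x‖ₑ * ENNReal.ofReal (Real.exp (-ε * x ^ 2)) ≤ ENNReal.ofReal (N ^ 2) := by
  obtain ⟨ha0, ha1⟩ := inv_toReal_mem hp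
  obtain ⟨hb0, hb1⟩ := inv_toReal_mem hq
  rcases le_total p q with hpq | hpq
  · filter_upwards [Ioo_mem_nhdsGT (show (0:ℝ) < 1 by norm_num)] with δ hδ f g hf hg h1 h2 h3
    calc ∫⁻ x, ‖f x‖ₑ * ‖g x‖ₑ * ENNReal.ofReal (Real.exp (-ε * x ^ 2))
        ≤ ∫⁻ x, ‖f x‖ₑ * ‖g x‖ₑ := by
          refine lintegral_mono fun x => ?_
          exact mul_le_of_le_one_right' (gauss_le_one hε x)
      _ ≤ eLpNorm f q volume * eLpNorm g qst volume := holder1 hqc hf hg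
      _ ≤ ENNReal.ofReal (N * δ ^ (-(p⁻¹.toReal - q⁻¹.toReal))) * ENNReal.ofReal (N * δ) := by
          gcongr
          exact interp hp hpq hN hδ.1 h1 h2
      _ ≤ _ := by
          have := hδ.1
          rw [← ENNReal.ofReal_mul (by positivity)]
          apply ENNReal.ofReal_le_ofReal
          have e : δ ^ (-(p⁻¹.toReal - q⁻¹.toReal)) * δ ≤ 1 := by
            nth_rewrite 2 [← Real.rpow_one δ]
            rw [← Real.rpow_add hδ.1]
            exact Real.rpow_le_one hδ.1.le hδ.2.le (by linarith)
          nlinarith [sq_nonneg N]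
  · have hle : p⁻¹ ≤ q⁻¹ := ENNReal.inv_le_inv.2 hpq
    set s := (q⁻¹ - p⁻¹)⁻¹ with hs
    have : ENNReal.HolderTriple p s q := ⟨by rw [hs, inv_inv, add_tsub_cancel_of_le hle]⟩
    have hs0 : s ≠ 0 := by
      rw [hs, ne_eq, ENNReal.inv_eq_zero]
      refine ((tsub_le_self.trans (ENNReal.inv_le_one.2 hq)).trans_lt ENNReal.one_lt_top).ne
    have hW := gauss_memLp hs0 hε
    set w : ℝ → ℂ := (fun x : ℝ => ((Real.exp (-ε * x ^ 2) : ℝ) : ℂ)) with hw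
    set W := (eLpNorm w s volume).toReal with hWW
    have hWe : eLpNorm w s volume = ENNReal.ofReal W := (ENNReal.ofReal_toReal hW.ne).symm
    have hW0 : 0 ≤ W := ENNReal.toReal_nonneg
    have hwm : Measurable w := by
      apply Complex.measurable_ofReal.comp; fun_prop
    filter_upwards [Ioo_mem_nhdsGT (show (0:ℝ) < (1 + W)⁻¹ by positivity)] with δ hδ f g hf hg h1 h2 h3
    calc ∫⁻ x, ‖f x‖ₑ * ‖g x‖ₑ * ENNReal.ofReal (Real.exp (-ε * x ^ 2))
        = ∫⁻ x, ‖(f • w) x‖ₑ * ‖g x‖ₑ := by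
          congr 1 with x
          rw [Pi.smul_apply', smul_eq_mul, enorm_mul, mul_right_comm]
          congr 2
          rw [hw, ← ofReal_norm, Complex.norm_real, Real.norm_of_nonneg (by positivity)]
      _ ≤ eLpNorm (f • w) q volume * eLpNorm g qst volume := holder1 hqc (hf.smul hwm) hg
      _ ≤ (ENNReal.ofReal N * ENNReal.ofReal W) * ENNReal.ofReal (N * δ) := by
          gcongr
          refine (eLpNorm_smul_le_mul_eLpNorm (p := p) (q := s) hwm.aestronglyMeasurable
            hf.aestronglyMeasurable).trans ?_
          rw [hWe]
          gcongr
      _ ≤ _ := by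
          have := hδ.1
          rw [← ENNReal.ofReal_mul (by positivity), ← ENNReal.ofReal_mul (by positivity)]
          apply ENNReal.ofReal_le_ofReal
          have e : W * δ ≤ 1 := by
            have h5 := hδ.2.le
            calc W * δ ≤ (1 + W) * (1 + W)⁻¹ := by gcongr; linarith
              _ = 1 := mul_inv_cancel₀ (by positivity)
          nlinarith [sq_nonneg N]

lemma Dec.mono {p q : ℝ≥0∞} {h : ℂ → ℂ} {N N' : ℝ} (hD : Dec p q h N) (hN : N ≤ N') :
    Dec p q h N' := by
  intro y hy
  obtain ⟨E, hE, h1, h2⟩ := hD y hy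
  refine ⟨E, hE, h1.trans (ENNReal.ofReal_le_ofReal ?_), h2.trans (ENNReal.ofReal_le_ofReal ?_)⟩
  · nlinarith [hy.2]
  · nlinarith [hy.1]

lemma low {p q pst qst : ℝ≥0∞} (hp : 1 ≤ p) (hq : 1 ≤ q) (hp' : 1 ≤ pst) (hq' : 1 ≤ qst)
    (hpc : p⁻¹ + pst⁻¹ = 1) (hqc : q⁻¹ + qst⁻¹ = 1) {h m : ℂ → ℂ} {N : ℝ} (hN : 1 ≤ N)
    (hd : DifferentiableOn ℂ h Strip) (hD : Dec p q h N)
    (md : DifferentiableOn ℂ m Strip) (mD : Dec pst qst m N) {ε : ℝ} (hε : 0 < ε) :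
    ∀ᶠ δ in 𝓝[>] (0:ℝ), ∫⁻ x, ‖bLine (fun z => m z * h z) δ x‖ₑ *
      ENNReal.ofReal (Real.exp (-ε * x ^ 2)) ≤ ENNReal.ofReal (400 * N ^ 2) := by
  have c1 := cross hp hq hqc (N := 10 * N) (by linarith) hε
  have c2 := cross hp' hq' (by rw [add_comm]; exact hqc) (qst := q) (N := 10 * N) (by linarith) hε
  filter_upwards [c1, c2, Ioo_mem_nhdsGT (show (0:ℝ) < 1 / 2 by norm_num)] with δ c1 c2 hδ
  have hδ' : δ ∈ Ioo (0:ℝ) 1 := ⟨hδ.1, by linarith [hδ.2]⟩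
  have hδ0 := hδ.1
  have hδ1 : 0 < 1 - δ := by linarith [hδ.2]
  obtain ⟨E, hE, h1, h2⟩ := hD δ hδ'
  obtain ⟨G, hG, m1, m2⟩ := mD δ hδ'
  have hb := (bLine_continuous hd hδ').measurable
  have mb := (bLine_continuous md hδ').measurable
  have ph : ∀ x, ‖bLine h δ x‖ ≤ 10 * N * δ ^ (-p⁻¹.toReal) := by
    intro x
    simpa [bLine] using pointwise_low hp hq hN hd hD (x + δ * I) (by simpa using hδ.1)
      (by simpa using hδ.2)
  have pm : ∀ x, ‖bLine m δ x‖ ≤ 10 * N * δ ^ (-pst⁻¹.toReal) := by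
    intro x
    simpa [bLine] using pointwise_low hp' hq' hN md mD (x + δ * I) (by simpa using hδ.1)
      (by simpa using hδ.2)
  set f := E.indicator (bLine h δ) with hf
  set g := Eᶜ.indicator (bLine h δ) with hg
  set f' := G.indicator (bLine m δ) with hf'
  set g' := Gᶜ.indicator (bLine m δ) with hg'
  have fm : Measurable f := hb.indicator hE
  have gm : Measurable g := hb.indicator hE.compl
  have fm' : Measurable f' := mb.indicator hG
  have gm' : Measurable g' := mb.indicator hG.compl
  have t1 := c1 f g' fm gm' (h1.trans (ENNReal.ofReal_le_ofReal (by nlinarith)))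
    (fun x => (norm_indicator_le_norm_self _ _).trans (ph x))
    (m2.trans (ENNReal.ofReal_le_ofReal (by nlinarith)))
  have t2 := c2 f' g fm' gm (m1.trans (ENNReal.ofReal_le_ofReal (by nlinarith)))
    (fun x => (norm_indicator_le_norm_self _ _).trans (pm x))
    (h2.trans (ENNReal.ofReal_le_ofReal (by nlinarith)))
  have t3 : ∫⁻ x, ‖f x‖ₑ * ‖f' x‖ₑ ≤ ENNReal.ofReal (N ^ 2) := by
    refine (holder1 hpc fm fm').trans ((mul_le_mul' h1 m1).trans ?_)
    rw [← ENNReal.ofReal_mul (by positivity)]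
    apply ENNReal.ofReal_le_ofReal
    have : N * (1 - δ) ≤ N := by nlinarith
    have : 0 ≤ N * (1 - δ) := by positivity
    nlinarith
  have t4 : ∫⁻ x, ‖g x‖ₑ * ‖g' x‖ₑ ≤ ENNReal.ofReal (N ^ 2) := by
    refine (holder1 hqc gm gm').trans ((mul_le_mul' h2 m2).trans ?_)
    rw [← ENNReal.ofReal_mul (by positivity)]
    apply ENNReal.ofReal_le_ofReal
    have : N * δ ≤ N := by nlinarith
    have : 0 ≤ N * δ := by positivity
    nlinarith
  set w : ℝ → ℝ≥0∞ := fun x => ENNReal.ofReal (Real.exp (-ε * x ^ 2)) with hw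
  have wm : Measurable w := by fun_prop
  calc ∫⁻ x, ‖bLine (fun z => m z * h z) δ x‖ₑ * w x
      ≤ ∫⁻ x, ((‖f x‖ₑ * ‖g' x‖ₑ * w x + ‖f' x‖ₑ * ‖g x‖ₑ * w x) +
          (‖f x‖ₑ * ‖f' x‖ₑ + ‖g x‖ₑ * ‖g' x‖ₑ)) := by
        refine lintegral_mono fun x => ?_
        have hwx : w x ≤ 1 := gauss_le_one hε x
        have e : ‖bLine (fun z => m z * h z) δ x‖ₑ = ‖bLine h δ x‖ₑ * ‖bLine m δ x‖ₑ := by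
          simp only [bLine, enorm_mul]; rw [mul_comm]
        have hle : ‖bLine h δ x‖ₑ * ‖bLine m δ x‖ₑ * w x ≤ ‖bLine h δ x‖ₑ * ‖bLine m δ x‖ₑ :=
          mul_le_of_le_one_right' hwx
        rw [e]
        by_cases hx : x ∈ E <;> by_cases hx' : x ∈ G <;>
          simp [hf, hg, hf', hg', hx, hx', hle]
        rw [mul_comm ‖bLine h δ x‖ₑ]
    _ = ((∫⁻ x, ‖f x‖ₑ * ‖g' x‖ₑ * w x) + ∫⁻ x, ‖f' x‖ₑ * ‖g x‖ₑ * w x) +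
          ((∫⁻ x, ‖f x‖ₑ * ‖f' x‖ₑ) + ∫⁻ x, ‖g x‖ₑ * ‖g' x‖ₑ) := by
        rw [lintegral_add_left (by fun_prop), lintegral_add_left (by fun_prop),
          lintegral_add_left (by fun_prop)]
    _ ≤ (ENNReal.ofReal ((10 * N) ^ 2) + ENNReal.ofReal ((10 * N) ^ 2)) +
         (ENNReal.ofReal (N ^ 2) + ENNReal.ofReal (N ^ 2)) := by gcongr
    _ ≤ _ := by
        rw [← ENNReal.ofReal_add (by positivity) (by positivity),
          ← ENNReal.ofReal_add (by positivity) (by positivity),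
          ← ENNReal.ofReal_add (by positivity) (by positivity)]
        apply ENNReal.ofReal_le_ofReal
        nlinarith [sq_nonneg N]

lemma bLine_refl (h : ℂ → ℂ) (y x : ℝ) :
    bLine (fun z => h (I - z)) y x = bLine h (1 - y) (-x) := by
  simp only [bLine]
  congr 1
  push_cast; ring

lemma refl_diff {h : ℂ → ℂ} (hd : DifferentiableOn ℂ h Strip) :
    DifferentiableOn ℂ (fun z => h (I - z)) Strip := by
  refine hd.comp (by fun_prop) ?_
  rintro z ⟨h0, h1⟩
  refine ⟨?_, ?_⟩ <;> simp <;> assumption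

lemma refl_Dec {p q : ℝ≥0∞} {h : ℂ → ℂ} {N : ℝ} (hd : DifferentiableOn ℂ h Strip)
    (hD : Dec p q h N) : Dec q p (fun z => h (I - z)) N := by
  intro y hy
  have hy' : 1 - y ∈ Ioo (0:ℝ) 1 := ⟨by linarith [hy.2], by linarith [hy.1]⟩
  obtain ⟨E, hE, h1, h2⟩ := hD (1 - y) hy'
  have hb := (bLine_continuous hd hy').measurable
  have key : ∀ (A : Set ℝ), MeasurableSet A → ∀ s : ℝ≥0∞,
      eLpNorm ((Neg.neg ⁻¹' A).indicator (bLine (fun z => h (I - z)) y)) s volume =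
      eLpNorm (A.indicator (bLine h (1 - y))) s volume := by
    intro A hA s
    rw [← eLpNorm_comp_measurePreserving (hb.indicator hA).aestronglyMeasurable
      (Measure.measurePreserving_neg (volume : Measure ℝ))]
    congr 1
    funext x
    by_cases hx : -x ∈ A
    · rw [Function.comp, indicator_of_mem hx, indicator_of_mem (by exact hx), bLine_refl]
    · rw [Function.comp, indicator_of_notMem hx, indicator_of_notMem (by exact hx)]
  refine ⟨Neg.neg ⁻¹' Eᶜ, measurable_neg hE.compl, ?_, ?_⟩
  · rw [key _ hE.compl]; exact h2
  · rw [← preimage_compl, compl_compl, key _ hE]; convert h1 using 2; ring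

lemma high {p q pst qst : ℝ≥0∞} (hp : 1 ≤ p) (hq : 1 ≤ q) (hp' : 1 ≤ pst) (hq' : 1 ≤ qst)
    (hpc : p⁻¹ + pst⁻¹ = 1) (hqc : q⁻¹ + qst⁻¹ = 1) {h m : ℂ → ℂ} {N : ℝ} (hN : 1 ≤ N)
    (hd : DifferentiableOn ℂ h Strip) (hD : Dec p q h N)
    (md : DifferentiableOn ℂ m Strip) (mD : Dec pst qst m N) {ε : ℝ} (hε : 0 < ε) :
    ∀ᶠ δ in 𝓝[>] (0:ℝ), ∫⁻ x, ‖bLine (fun z => m z * h z) (1 - δ) x‖ₑ *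
      ENNReal.ofReal (Real.exp (-ε * x ^ 2)) ≤ ENNReal.ofReal (400 * N ^ 2) := by
  filter_upwards [low hq hp hq' hp' hqc hpc hN (refl_diff hd) (refl_Dec hd hD)
    (refl_diff md) (refl_Dec md mD) hε] with δ hδ
  refine le_trans (le_of_eq ?_) hδ
  rw [← lintegral_neg_eq_self]
  congr 1 with x
  rw [bLine_refl (fun z => m z * h z), neg_sq]

lemma norm_gauss (ε x y : ℝ) : ‖Complex.exp (-ε * ((x : ℂ) + y * I) ^ 2)‖ =
    Real.exp (ε * y ^ 2) * Real.exp (-ε * x ^ 2) := by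
  rw [Complex.norm_exp, ← Real.exp_add]
  congr 1
  simp [pow_two]
  ring

lemma main_bound {p q pst qst : ℝ≥0∞} (hp : 1 ≤ p) (hq : 1 ≤ q) (hp' : 1 ≤ pst) (hq' : 1 ≤ qst)
    (hpc : p⁻¹ + pst⁻¹ = 1) (hqc : q⁻¹ + qst⁻¹ = 1) {h m : ℂ → ℂ} {N : ℝ} (hN : 1 ≤ N)
    (hd : DifferentiableOn ℂ h Strip) (hD : Dec p q h N)
    (md : DifferentiableOn ℂ m Strip) (mD : Dec pst qst m N) {y : ℝ} (hy : y ∈ Ioo (0:ℝ) 1) :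
    ∫⁻ x, ‖bLine (fun z => m z * h z) y x‖ₑ ≤ ENNReal.ofReal (3 * (400 * N ^ 2)) := by
  have Fd : DifferentiableOn ℂ (fun z => m z * h z) Strip := md.mul hd
  have Fc := bLine_continuous Fd hy
  have key : ∀ ε : ℝ, 0 < ε → ε ≤ 1 → ∫⁻ x, ‖bLine (fun z => m z * h z) y x‖ₑ *
      ENNReal.ofReal (Real.exp (-ε * x ^ 2)) ≤ ENNReal.ofReal (3 * (400 * N ^ 2)) := by
    intro ε hε hε1
    set Φ : ℂ → ℂ := fun z => m z * h z * Complex.exp (-ε * z ^ 2) with hΦ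
    have Φd : DifferentiableOn ℂ Φ Strip := Fd.mul (by fun_prop)
    have hn : ∀ (t x : ℝ), ‖bLine Φ t x‖ₑ = ‖bLine (fun z => m z * h z) t x‖ₑ *
        (ENNReal.ofReal (Real.exp (ε * t ^ 2)) * ENNReal.ofReal (Real.exp (-ε * x ^ 2))) := by
      intro t x
      rw [← ENNReal.ofReal_mul (by positivity), ← norm_gauss, ofReal_norm, ← enorm_mul]
      rfl
    have hup : ∀ t ∈ Ioo (0:ℝ) 1, ENNReal.ofReal (Real.exp (ε * t ^ 2)) ≤ ENNReal.ofReal 3 := by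
      intro t ht
      apply ENNReal.ofReal_le_ofReal
      have h1 : ε * t ^ 2 ≤ 1 := by nlinarith [ht.1, ht.2, sq_nonneg t]
      have := Real.exp_one_lt_d9
      linarith [Real.exp_le_exp.2 h1]
    have hbd : ∀ t ∈ Ioo (0:ℝ) 1, (∫⁻ x, ‖bLine (fun z => m z * h z) t x‖ₑ *
        ENNReal.ofReal (Real.exp (-ε * x ^ 2)) ≤ ENNReal.ofReal (400 * N ^ 2)) →
        ∫⁻ x, ‖bLine Φ t x‖ₑ ≤ ENNReal.ofReal (3 * (400 * N ^ 2)) := by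
      intro t ht hle
      rw [ENNReal.ofReal_mul (by norm_num)]
      refine le_trans ?_ (mul_le_mul' (hup t ht) hle)
      rw [← lintegral_const_mul' _ _ ENNReal.ofReal_ne_top]
      refine le_of_eq (lintegral_congr fun x => ?_)
      rw [hn]; ring
    have hlb : LocBdd Φ := by
      intro α β hα hβ
      obtain ⟨B1, hB1, hb1⟩ := bounded_sub hp hq hN hd hD α β hα hβ
      obtain ⟨B2, hB2, hb2⟩ := bounded_sub hp' hq' hN md mD α β hα hβ
      refine ⟨B2 * B1 * 3, by positivity, fun z hz1 hz2 => ?_⟩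
      have hg : ‖Complex.exp (-ε * z ^ 2)‖ ≤ 3 := by
        rw [← Complex.re_add_im z, norm_gauss]
        have h1 : ε * z.im ^ 2 ≤ 1 := by
          have : z.im ^ 2 ≤ 1 := by nlinarith
          nlinarith [sq_nonneg z.im]
        have h2 : -ε * z.re ^ 2 ≤ 0 := by nlinarith [sq_nonneg z.re]
        have := Real.exp_one_lt_d9
        have h3 := Real.exp_le_exp.2 h1
        have h4 := Real.exp_le_one_iff.2 h2
        calc Real.exp (ε * z.im ^ 2) * Real.exp (-ε * z.re ^ 2) ≤ 3 * 1 :=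
              mul_le_mul (by linarith) h4 (by positivity) (by norm_num)
          _ = 3 := by norm_num
      rw [hΦ]
      simp only [norm_mul]
      gcongr
      · exact hb2 z hz1 hz2
      · exact hb1 z hz1 hz2
    have hmin : 0 < min y (1 - y) := lt_min hy.1 (by linarith [hy.2])
    obtain ⟨δ, hl, hh, hδ⟩ := ((low hp hq hp' hq' hpc hqc hN hd hD md mD hε).and
      ((high hp hq hp' hq' hpc hqc hN hd hD md mD hε).and (Ioo_mem_nhdsGT hmin))).exists
    have hδ1 : δ < y := hδ.2.trans_le (min_le_left _ _)
    have hδ2 : δ < 1 - y := hδ.2.trans_le (min_le_right _ _)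
    have := hδ.1
    have h3 := three_lines Φd hlb δ (1 - δ) y (3 * (400 * N ^ 2)) hδ.1 hδ1 (by linarith)
      (by linarith) (by positivity) (hbd δ ⟨hδ.1, by linarith [hy.2]⟩ hl)
      (hbd (1 - δ) ⟨by linarith [hy.1], by linarith⟩ hh)
    refine le_trans (lintegral_mono fun x => ?_) h3
    rw [hn]
    gcongr
    refine le_mul_of_one_le_left' ?_
    rw [ENNReal.one_le_ofReal]
    exact Real.one_le_exp (by positivity)
  set u : ℕ → ℝ → ℝ≥0∞ := fun n x => ‖bLine (fun z => m z * h z) y x‖ₑ *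
      ENNReal.ofReal (Real.exp (-(1 / ((n:ℝ) + 1)) * x ^ 2)) with hu
  have hlim : ∀ x, Tendsto (fun n => u n x) atTop (𝓝 ‖bLine (fun z => m z * h z) y x‖ₑ) := by
    intro x
    have h1 : Tendsto (fun n : ℕ => ENNReal.ofReal (Real.exp (-(1 / ((n:ℝ) + 1)) * x ^ 2)))
        atTop (𝓝 1) := by
      have h0 := (tendsto_one_div_add_atTop_nhds_zero_nat (𝕜 := ℝ)).neg.mul_const (x ^ 2)
      have h2 := ENNReal.tendsto_ofReal ((Real.continuous_exp.tendsto _).comp h0)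
      simpa using h2
    have := ENNReal.Tendsto.const_mul (a := ‖bLine (fun z => m z * h z) y x‖ₑ) h1
      (Or.inr enorm_ne_top)
    rw [mul_one] at this
    exact this
  calc ∫⁻ x, ‖bLine (fun z => m z * h z) y x‖ₑ = ∫⁻ x, liminf (fun n => u n x) atTop :=
        lintegral_congr fun x => (hlim x).liminf_eq.symm
    _ ≤ liminf (fun n => ∫⁻ x, u n x) atTop := by
        apply lintegral_liminf_le
        intro n
        exact Fc.measurable.enorm.mul (by fun_prop)
    _ ≤ _ := by
        refine liminf_le_of_frequently_le' (Frequently.of_forall fun n => ?_)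
        refine key _ (by positivity) ?_
        rw [div_le_one (by positivity)]
        have : (0:ℝ) ≤ n := Nat.cast_nonneg n
        linarith

lemma one_le_of_conj {p pst : ℝ≥0∞} (hpc : p⁻¹ + pst⁻¹ = 1) : 1 ≤ pst := by
  rw [← ENNReal.inv_le_one, ← hpc]
  exact le_add_self

/-- **Multiplication property** (Lemma 2.9): the product of a function in `H^{p,q}(S)`
with one in `H^{p*,q*}(S)` lies in the classical Hardy space `H¹(S) = H^{1,1}(S)`. -/
theorem multiplication_property (p q pst qst : ℝ≥0∞) (hp : 1 ≤ p) (hq : 1 ≤ q)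
    (hpc : p⁻¹ + pst⁻¹ = 1) (hqc : q⁻¹ + qst⁻¹ = 1)
    (h m : ℂ → ℂ) (hh : MemHardy p q h) (hm : MemHardy pst qst m) :
    MemHardy 1 1 (fun z => m z * h z) := by
  have hp' := one_le_of_conj hpc
  have hq' := one_le_of_conj hqc
  obtain ⟨N1, hN1, hD1⟩ := exists_Dec hh
  obtain ⟨N2, hN2, hD2⟩ := exists_Dec hm
  set N := max N1 N2 with hN
  have hN0 : 1 ≤ N := hN1.trans (le_max_left _ _)
  have Fd : DifferentiableOn ℂ (fun z => m z * h z) Strip := hm.1.mul hh.1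
  refine ⟨Fd, ?_⟩
  set C := ENNReal.ofReal (3 * (400 * N ^ 2)) with hC
  refine lt_of_le_of_lt (b := C + C) ?_ (ENNReal.add_lt_top.2 ⟨ENNReal.ofReal_lt_top, ENNReal.ofReal_lt_top⟩)
  refine iSup₂_le fun y hy => ?_
  have hb := main_bound hp hq hp' hq' hpc hqc hN0 hh.1 (hD1.mono (le_max_left _ _)) hm.1
    (hD2.mono (le_max_right _ _)) hy
  rw [← eLpNorm_one_eq_lintegral_enorm] at hb
  have hbm := (bLine_continuous Fd hy).measurable
  have key : ∀ t : ℝ, 0 < t → ENNReal.ofReal t⁻¹ *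
      eLpNorm ((t : ℂ) • bLine (fun z => m z * h z) y) 1 volume ≤ C := by
    intro t ht
    rw [eLpNorm_const_smul, ← ofReal_norm, Complex.norm_real, Real.norm_of_nonneg ht.le,
      ← mul_assoc, ← ENNReal.ofReal_mul (by positivity), inv_mul_cancel₀ ht.ne']
    rw [ENNReal.ofReal_one, one_mul]
    exact hb
  refine iInf_le_of_le (((1 - y : ℝ) : ℂ) • bLine (fun z => m z * h z) y) ?_
  refine iInf_le_of_le ((y : ℂ) • bLine (fun z => m z * h z) y) ?_
  refine iInf_le_of_le (hbm.const_smul _) (iInf_le_of_le (hbm.const_smul _) (iInf_le_of_le ?_ ?_))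
  · rw [← add_smul]; push_cast; simp
  · exact add_le_add (key _ (by linarith [hy.2])) (key _ hy.1)
end
end

section
/- Let 0 < y < 1 and let 𝓟_y(x) := sin(πy) / (2(cosh(πx) − cos(πy))). Then for every real k ≠ 0, ∫_ℝ 𝓟_y(x) e^{−ikx} dx = sinh((1−y)k) / sinh(k), and moreover ∫_ℝ 𝓟_y(x) dx = 1 − y (so ‖𝓟_y‖_{L¹(ℝ)} = 1 − y since 𝓟_y > 0). -/
open MeasureTheory Complex Filter Set
open scoped Real ENNReal Topology

noncomputable section

lemma Pker_pos' {y : ℝ} (hy : y ∈ Set.Ioo (0:ℝ) 1) (x : ℝ) : 0 < Pker y x := by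
  obtain ⟨h0, h1⟩ := hy
  have hs : 0 < Real.sin (π * y) := Real.sin_pos_of_pos_of_lt_pi (by positivity) (by nlinarith [Real.pi_pos])
  have hc : Real.cos (π * y) < 1 := by nlinarith [Real.sin_sq_add_cos_sq (π * y), Real.cos_le_one (π*y)]
  have := Real.one_le_cosh (π * x)
  unfold Pker
  apply div_pos hs
  linarith

lemma one_add_sq_le_cosh' (x : ℝ) : 1 + x ^ 2 / 2 ≤ Real.cosh x := by
  have h := Real.cosh_two_mul (x / 2)
  have h2 := Real.cosh_sq (x / 2)
  rw [mul_div_cancel₀ _ (by norm_num)] at h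
  have h3 : (x/2)^2 ≤ Real.sinh (x/2) ^ 2 := by
    apply sq_le_sq.2
    rcases le_total 0 x with hx | hx
    · have := Real.self_le_sinh_iff.2 (show 0 ≤ x/2 by linarith)
      rw [abs_of_nonneg (by linarith), abs_of_nonneg (by linarith)]; exact this
    · have := Real.sinh_le_self_iff.2 (show x/2 ≤ 0 by linarith)
      rw [abs_of_nonpos (by linarith), abs_of_nonpos (by linarith)]; linarith
  nlinarith

lemma Pker_integrable {y : ℝ} (hy : y ∈ Set.Ioo (0:ℝ) 1) : Integrable (Pker y) := by
  have hpos := Pker_pos' hy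
  obtain ⟨h0, h1⟩ := hy
  have hs : 0 < Real.sin (π * y) := Real.sin_pos_of_pos_of_lt_pi (by positivity) (by nlinarith [Real.pi_pos])
  have hc : Real.cos (π * y) < 1 := by nlinarith [Real.sin_sq_add_cos_sq (π * y), Real.cos_le_one (π*y)]
  have hd : 0 < (1 - Real.cos (π * y)) / 2 := by linarith
  refine Integrable.mono' ((integrable_inv_one_add_sq).const_mul
    (((1 - Real.cos (π * y)) / 2)⁻¹)) ?_ ?_
  · apply Continuous.aestronglyMeasurable
    unfold Pker
    refine Continuous.div (by fun_prop) (by fun_prop) ?_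
    intro x
    have := Real.one_le_cosh (π * x)
    linarith
  · refine Eventually.of_forall fun x => ?_
    rw [Real.norm_eq_abs, abs_of_pos (hpos x), ← mul_inv, Pker, ← one_div]
    have hq := one_add_sq_le_cosh' (π * x)
    have hpi : 1 ≤ π ^ 2 := by nlinarith [Real.pi_gt_three]
    have hx2 : x ^ 2 ≤ (π * x) ^ 2 := by rw [mul_pow]; nlinarith [sq_nonneg x]
    have hm := Real.neg_one_le_cos (π * y)
    apply div_le_div₀ zero_le_one (Real.sin_le_one _) (by positivity)
    nlinarith [sq_nonneg x]

lemma phi_integrable (x c : ℝ) (hc : 0 < c) :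
    IntegrableOn (fun k : ℝ => cexp (-(c * k)) * (cexp (-(I * k * x)) + cexp (I * k * x))) (Ioi 0) := by
  have h1 := integrableOn_exp_mul_complex_Ioi (a := -(c + I * x)) (by simpa using hc) 0
  have h2 := integrableOn_exp_mul_complex_Ioi (a := -(c - I * x)) (by simpa using hc) 0
  refine (h1.add h2).congr (Eventually.of_forall fun k => ?_)
  simp only [Pi.add_apply, mul_add, ← Complex.exp_add]
  congr 2 <;> ring

lemma phi_integral (x c : ℝ) (hc : 0 < c) :
    ∫ k in Ioi (0:ℝ), cexp (-(c * k)) * (cexp (-(I * k * x)) + cexp (I * k * x))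
      = 1 / (c + I * x) + 1 / (c - I * x) := by
  have h1 := integrableOn_exp_mul_complex_Ioi (a := -(c + I * x)) (by simpa using hc) 0
  have h2 := integrableOn_exp_mul_complex_Ioi (a := -(c - I * x)) (by simpa using hc) 0
  have e1 := integral_exp_mul_complex_Ioi (a := -(c + I * x)) (by simpa using hc) 0
  have e2 := integral_exp_mul_complex_Ioi (a := -(c - I * x)) (by simpa using hc) 0
  have h := integral_add h1 h2
  rw [e1, e2] at h
  simp only [ofReal_zero, mul_zero, Complex.exp_zero, neg_div_neg_eq] at h
  rw [← h]
  congr 1; ext k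
  simp only [mul_add, ← Complex.exp_add]
  congr 2 <;> ring

/-- regularised quotient -/
def gq (y k : ℝ) : ℝ := dslope (fun k => Real.sinh ((1 - y) * k)) 0 k / dslope Real.sinh 0 k

lemma gq_of_ne (y : ℝ) {k : ℝ} (hk : k ≠ 0) : gq y k = Real.sinh ((1 - y) * k) / Real.sinh k := by
  rw [gq, dslope_of_ne _ hk, dslope_of_ne _ hk]
  simp only [slope_def_field, mul_zero, Real.sinh_zero, sub_zero]
  have : Real.sinh k ≠ 0 := by simpa using hk
  field_simp

lemma gq_zero (y : ℝ) : gq y 0 = 1 - y := by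
  rw [gq, dslope_same, dslope_same]
  have h : HasDerivAt (fun k => Real.sinh ((1 - y) * k)) (Real.cosh ((1-y)*0) * ((1-y)*1)) 0 :=
    ((hasDerivAt_id (0:ℝ)).const_mul (1-y)).sinh
  rw [h.deriv, Real.deriv_sinh]; simp

lemma gq_cont (y : ℝ) : Continuous (gq y) := by
  unfold gq
  refine Continuous.div ?_ ?_ ?_
  · rw [← continuousOn_univ, continuousOn_dslope univ_mem]
    exact ⟨by fun_prop, by fun_prop⟩
  · rw [← continuousOn_univ, continuousOn_dslope univ_mem]
    exact ⟨by fun_prop, by fun_prop⟩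
  · intro k
    rcases eq_or_ne k 0 with rfl | hk
    · rw [dslope_same, Real.deriv_sinh]; simp
    · rw [dslope_of_ne _ hk]
      simp [slope_def_field, hk]

lemma gq_neg (y k : ℝ) : gq y (-k) = gq y k := by
  rcases eq_or_ne k 0 with rfl | hk
  · simp
  · rw [gq_of_ne _ hk, gq_of_ne _ (neg_ne_zero.2 hk)]; simp [neg_div_neg_eq]

lemma hs_cast {E : Type*} [NormedAddCommGroup E] {f g : ℕ → E} {a b : E} (h : HasSum f a)
    (hf : ∀ n, g n = f n) (hb : b = a) : HasSum g b := by
  rw [hb, show g = f from funext hf]; exact h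

lemma gq_hasSum (y : ℝ) {k : ℝ} (hk : 0 < k) :
    HasSum (fun n : ℕ => Real.exp (-((2 * (n + 1) + y) * k)) - Real.exp (-((2 * (n + 1) - y) * k)))
      (gq y k - Real.exp (-(y * k))) := by
  have hlt : Real.exp (-(2 * k)) < 1 := by simpa using hk
  have h := (hasSum_geometric_of_lt_one (Real.exp_pos (-(2*k))).le hlt).mul_left
    (Real.exp (-(2 * k)) * (Real.exp (-(y * k)) - Real.exp (y * k)))
  refine hs_cast h (fun n => ?_) ?_
  · rw [← Real.exp_nat_mul, mul_sub, sub_mul (Real.exp _ * _), ← Real.exp_add, ← Real.exp_add,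
      ← Real.exp_add, ← Real.exp_add]
    congr 2 <;> ring
  · rw [gq_of_ne _ hk.ne', Real.sinh_eq, Real.sinh_eq]
    have e1 : Real.exp ((1 - y) * k) = Real.exp k * (Real.exp (y * k))⁻¹ := by
      rw [← Real.exp_neg, ← Real.exp_add]; ring_nf
    have e2 : Real.exp (-((1 - y) * k)) = (Real.exp k)⁻¹ * Real.exp (y * k) := by
      rw [← Real.exp_neg, ← Real.exp_add]; ring_nf
    have e3 : Real.exp (-(2 * k)) = ((Real.exp k)⁻¹) ^ 2 := by
      rw [← Real.exp_neg, ← Real.exp_nat_mul]; push_cast; ring_nf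
    have hk1 : 1 < Real.exp k := by simpa using hk
    rw [e1, e2, e3, Real.exp_neg, Real.exp_neg]
    have hy := Real.exp_pos (y * k)
    generalize Real.exp k = A at *
    generalize Real.exp (y * k) = B at *
    have h1 : A ^ 2 - 1 ≠ 0 := by nlinarith
    have hA : A ≠ 0 := by positivity
    have h2 : (1 - A⁻¹ ^ 2) = (A ^ 2 - 1) / A ^ 2 := by field_simp
    have h3 : (A - A⁻¹) / 2 = (A ^ 2 - 1) / (2 * A) := by field_simp
    rw [h2, h3]
    field_simp
    ring

lemma gq_nonneg {y : ℝ} (hy : y ∈ Set.Ioo (0:ℝ) 1) {k : ℝ} (hk : 0 < k) : 0 ≤ gq y k := by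
  rw [gq_of_ne _ hk.ne']
  have : 0 < 1 - y := by linarith [hy.2]
  exact div_nonneg (Real.sinh_nonneg_iff.2 (by positivity)) (Real.sinh_nonneg_iff.2 hk.le)

lemma gq_le {y : ℝ} (hy : y ∈ Set.Ioo (0:ℝ) 1) {k : ℝ} (hk : 0 < k) : gq y k ≤ Real.exp (-(y * k)) := by
  have := (gq_hasSum y hk).nonpos fun n => by
    rw [sub_nonpos, Real.exp_le_exp]
    nlinarith [mul_pos hy.1 hk]
  linarith

lemma gq_integrable {y : ℝ} (hy : y ∈ Set.Ioo (0:ℝ) 1) : Integrable (gq y) := by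
  have h1 : IntegrableOn (gq y) (Ioi 0) := by
    refine Integrable.mono' (integrableOn_exp_mul_Ioi (a := -y) (by linarith [hy.1]) 0)
      (gq_cont y).aestronglyMeasurable ?_
    refine (ae_restrict_iff' measurableSet_Ioi).2 (Eventually.of_forall fun k hk => ?_)
    rw [Real.norm_eq_abs, abs_of_nonneg (gq_nonneg hy hk), neg_mul]
    exact gq_le hy hk
  have h2 : IntegrableOn (gq y) (Iio 0) := by
    have : IntegrableOn (gq y) (Ioi (-0)) := by simpa using h1
    refine this.comp_neg_Iio.congr (Eventually.of_forall fun k => gq_neg y k)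
  rw [← integrableOn_univ, ← Iic_union_Ioi (a := (0:ℝ))]
  exact ((integrableOn_Iic_iff_integrableOn_Iio (by simp)).2 h2).union h1

lemma cot_id {y : ℝ} (hy : y ∈ Set.Ioo (0:ℝ) 1) (x : ℝ) :
    HasSum (fun n : ℕ =>
      (1 / (((2 * (n + 1) + y : ℝ) : ℂ) + I * x) + 1 / (((2 * (n + 1) + y : ℝ) : ℂ) - I * x)) -
      (1 / (((2 * (n + 1) - y : ℝ) : ℂ) + I * x) + 1 / (((2 * (n + 1) - y : ℝ) : ℂ) - I * x)))
      (2 * π * Pker y x - (1 / (y + I * x) + 1 / (y - I * x))) := by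
  have key : ∀ t : ℝ, ((y + I * t) / 2 : ℂ) ∈ integerComplement := by
    rintro t ⟨n, hn⟩
    have := congrArg Complex.re hn
    simp at this
    have h0 : (0:ℝ) < n := by rw [this]; linarith [hy.1]
    have h1 : (n:ℝ) < 1 := by rw [this]; linarith [hy.2]
    have h0' : 0 < n := by exact_mod_cast h0
    have h1' : n < 1 := by exact_mod_cast h1
    omega
  have hs : ∀ t : ℝ, HasSum (fun n : ℕ => 1 / ((y + I * t) / 2 - ((n:ℂ) + 1)) + 1 / ((y + I * t) / 2 + ((n:ℂ) + 1)))
      (π * cot (π * ((y + I * t) / 2)) - 1 / ((y + I * t) / 2)) := by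
    intro t
    rw [cot_series_rep' (key t)]
    exact (summable_cotTerm (key t)).hasSum
  have hw := ((hs x).add (hs (-x))).mul_left (1/2 : ℂ)
  have hz : ∀ (c : ℝ) (t : ℝ), 0 < c → (c + I * t : ℂ) ≠ 0 := by
    intro c t hc h
    have := congrArg Complex.re h
    simp at this; linarith
  refine hs_cast hw (fun n => ?_) ?_
  · have a1 := hz (2 * (n + 1) + y) x (by have := hy.1; positivity)
    have a2 := hz (2 * (n + 1) + y) (-x) (by have := hy.1; positivity)
    have a3 := hz (2 * (n + 1) - y) x (by have := hy.2; have : (0:ℝ) ≤ n := by positivity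
                                          linarith)
    have a4 := hz (2 * (n + 1) - y) (-x) (by have := hy.2; have : (0:ℝ) ≤ n := by positivity
                                             linarith)
    push_cast at *
    have b : ∀ z : ℂ, 1 / 2 * (1 / (z / 2)) = 1 / z := by intro z; ring
    rw [show (y + I * x) / 2 - ((n:ℂ) + 1) = -((2 * (n + 1) - y + I * -x) / 2) by ring,
      show (y + I * -x) / 2 - ((n:ℂ) + 1) = -((2 * (n + 1) - y + I * x) / 2) by ring,
      show (y + I * x) / 2 + ((n:ℂ) + 1) = ((2 * (n + 1) + y + I * x) / 2) by ring,
      show (y + I * -x) / 2 + ((n:ℂ) + 1) = ((2 * (n + 1) + y + I * -x) / 2) by ring]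
    simp only [one_div_neg_eq_neg_one_div, mul_add, mul_neg, b]
    ring
  · have s1 := sin_pi_mul_ne_zero (key x)
    have s2 := sin_pi_mul_ne_zero (key (-x))
    push_cast at *
    simp only [Complex.cot]
    have hP : (Pker y x : ℂ) = (1/4) * (cos (π * ((y + I * x) / 2)) / sin (π * ((y + I * x) / 2)) +
        cos (π * ((y + I * -x) / 2)) / sin (π * ((y + I * -x) / 2))) := by
      rw [div_add_div _ _ s1 s2, Pker]
      push_cast
      have e1 : (π * y : ℂ) = π * ((y + I * x) / 2) + π * ((y + I * -x) / 2) := by ring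
      have e2 : cosh (π * x) = cos (π * ((y + I * x) / 2) - π * ((y + I * -x) / 2)) := by
        rw [← Complex.cos_mul_I]; congr 1; ring
      rw [e2, e1, Complex.sin_add, Complex.cos_add, Complex.cos_sub]
      generalize π * ((y + I * x) / 2) = A at *
      generalize π * ((y + I * -x) / 2) = B at *
      rw [show 2 * (cos A * cos B + sin A * sin B - (cos A * cos B - sin A * sin B)) = 4 * (sin A * sin B) by ring]
      field_simp
      ring
    have a1 := hz y x hy.1
    have a2 := hz y (-x) hy.1
    push_cast at *
    rw [hP]
    field_simp
    ring

lemma gq_half {y : ℝ} (hy : y ∈ Set.Ioo (0:ℝ) 1) (x : ℝ) :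
    ∫ k in Ioi (0:ℝ), (gq y k : ℂ) * (cexp (-(I * k * x)) + cexp (I * k * x)) = 2 * π * Pker y x := by
  have hy0 := hy.1
  have hy1 := hy.2
  have c1 : ∀ n : ℕ, (0:ℝ) < 2 * (n + 1) + y := fun n => by positivity
  have c2 : ∀ n : ℕ, (0:ℝ) < 2 * (n + 1) - y := fun n => by
    have : (0:ℝ) ≤ n := by positivity
    linarith
  set W : ℝ → ℂ := fun k => cexp (-(I * k * x)) + cexp (I * k * x) with hW
  have hWn : ∀ k, ‖W k‖ ≤ 2 := by
    intro k
    refine (norm_add_le _ _).trans ?_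
    rw [show -(I * k * x) = ((-(k * x) : ℝ) : ℂ) * I by push_cast; ring,
      show (I * k * x) = ((k * x : ℝ) : ℂ) * I by push_cast; ring,
      Complex.norm_exp_ofReal_mul_I, Complex.norm_exp_ofReal_mul_I]
    norm_num
  let F : ℕ → ℝ → ℂ := fun n k =>
    cexp (-((2 * (n + 1) + y : ℝ) * k)) * W k - cexp (-((2 * (n + 1) - y : ℝ) * k)) * W k
  have hFi : ∀ n, IntegrableOn (F n) (Ioi 0) := fun n =>
    (phi_integrable x _ (c1 n)).sub (phi_integrable x _ (c2 n))
  have hFI : ∀ n, ∫ k in Ioi (0:ℝ), F n k = _ := fun n =>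
    (integral_sub (phi_integrable x _ (c1 n)) (phi_integrable x _ (c2 n))).trans
      (congrArg₂ _ (phi_integral x _ (c1 n)) (phi_integral x _ (c2 n)))
  have hreal : ∀ c : ℝ, 0 < c → IntegrableOn (fun k : ℝ => Real.exp (-(c * k))) (Ioi 0) ∧
      ∫ k in Ioi (0:ℝ), Real.exp (-(c * k)) = 1 / c := by
    intro c hc
    have h1 := integrableOn_exp_mul_Ioi (a := -c) (by linarith) 0
    have h2 := integral_exp_mul_Ioi (a := -c) (by linarith) 0
    simp only [neg_mul] at h1 h2
    exact ⟨h1, by rw [h2]; simp⟩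
  have hbound : ∀ n, ∫ k in Ioi (0:ℝ), ‖F n k‖ ≤
      2 * (1 / (2 * (n + 1) - y) - 1 / (2 * (n + 1) + y)) := by
    intro n
    rw [← (hreal _ (c2 n)).2, ← (hreal _ (c1 n)).2,
      ← integral_sub (hreal _ (c2 n)).1 (hreal _ (c1 n)).1, ← integral_const_mul]
    refine setIntegral_mono_on (hFi n).norm
      (((hreal _ (c2 n)).1.sub (hreal _ (c1 n)).1).const_mul 2) measurableSet_Ioi ?_
    intro k hk
    have hk : 0 < k := hk
    have e : F n k = ((Real.exp (-((2 * (n + 1) + y) * k)) - Real.exp (-((2 * (n + 1) - y) * k)) : ℝ) : ℂ) * W k := by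
      simp only [F]; push_cast; ring
    rw [e, norm_mul, Complex.norm_real, Real.norm_eq_abs, abs_of_nonpos, mul_comm, neg_sub]
    · apply mul_le_mul_of_nonneg_right (hWn k)
      rw [sub_nonneg, Real.exp_le_exp]
      nlinarith [mul_pos hy0 hk]
    · rw [sub_nonpos, Real.exp_le_exp]
      nlinarith [mul_pos hy0 hk]
  have hsum : Summable fun n => ∫ k in Ioi (0:ℝ), ‖F n k‖ := by
    refine Summable.of_nonneg_of_le (fun n => integral_nonneg fun k => norm_nonneg _) hbound ?_
    have hb : Summable fun n : ℕ => 4 * (1 / ((n:ℝ) + 1) ^ 2) := by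
      apply Summable.mul_left
      exact_mod_cast (summable_nat_add_iff 1).2 (Real.summable_one_div_nat_pow.2 one_lt_two)
    refine Summable.of_nonneg_of_le (fun n => ?_) (fun n => ?_) hb
    · have := one_div_le_one_div_of_le (c2 n) (show (2 * (n + 1) - y : ℝ) ≤ 2 * (n + 1) + y by linarith)
      linarith
    · have a1 := c1 n
      have a2 := c2 n
      have hn : (0:ℝ) ≤ n := by positivity
      rw [div_sub_div _ _ a2.ne' a1.ne', mul_one_div, ← mul_div_assoc, div_le_div_iff₀ (by positivity) (by positivity)]
      have : y ^ 2 ≤ 1 := by nlinarith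
      nlinarith [sq_nonneg (n:ℝ)]
  have hmain := hasSum_integral_of_summable_integral_norm (μ := volume.restrict (Ioi (0:ℝ))) hFi hsum
  have hts : ∫ k in Ioi (0:ℝ), ∑' n, F n k = 2 * π * Pker y x - (1 / (y + I * x) + 1 / (y - I * x)) := by
    refine hmain.unique ?_
    exact hs_cast (cot_id hy x) hFI rfl
  have hpt : ∀ k ∈ Ioi (0:ℝ), ∑' n, F n k = (gq y k : ℂ) * W k - cexp (-(y * k)) * W k := by
    intro k hk
    have h := ((Complex.hasSum_ofReal).2 (gq_hasSum y hk)).mul_right (W k)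
    have h2 : HasSum (fun n => F n k) ((gq y k : ℂ) * W k - cexp (-(y * k)) * W k) := by
      refine hs_cast h (fun n => ?_) ?_
      · simp only [F]; push_cast; ring
      · push_cast; ring
    exact h2.tsum_eq
  rw [setIntegral_congr_fun measurableSet_Ioi hpt, integral_sub ?_ (phi_integrable x y hy0),
    phi_integral x y hy0] at hts
  · linear_combination hts
  · refine (gq_integrable hy).ofReal.integrableOn.mul_bdd (c := 2) ?_ ?_
    · exact Continuous.aestronglyMeasurable (by fun_prop)
    · exact Eventually.of_forall hWn

lemma gq_full {y : ℝ} (hy : y ∈ Set.Ioo (0:ℝ) 1) (x : ℝ) :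
    ∫ k : ℝ, (gq y k : ℂ) * cexp (-(I * k * x)) = 2 * π * Pker y x := by
  have hi : ∀ t : ℝ, Integrable (fun k : ℝ => (gq y k : ℂ) * cexp (-(I * k * t))) := by
    intro t
    refine (gq_integrable hy).ofReal.mul_bdd (c := 1) ?_ ?_
    · exact Continuous.aestronglyMeasurable (by fun_prop)
    · refine Eventually.of_forall fun k => ?_
      rw [show -(I * k * t) = ((-(k * t) : ℝ) : ℂ) * I by push_cast; ring,
        Complex.norm_exp_ofReal_mul_I]
  rw [← intervalIntegral.integral_Iic_add_Ioi (b := 0) (hi x).integrableOn (hi x).integrableOn, ← gq_half hy x]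
  have h := integral_comp_neg_Iic 0 (fun k : ℝ => (gq y k : ℂ) * cexp (I * k * x))
  simp only [gq_neg, neg_zero] at h
  have h' : ∫ k in Iic (0:ℝ), (gq y k : ℂ) * cexp (-(I * k * x)) = ∫ k in Ioi (0:ℝ), (gq y k : ℂ) * cexp (I * k * x) := by
    rw [← h]; congr 1; ext k; push_cast; ring_nf
  have hi2 := hi (-x)
  simp only [ofReal_neg, mul_neg, neg_neg] at hi2
  rw [h', ← integral_add hi2.integrableOn (hi x).integrableOn]
  congr 1; ext k; ring

lemma Pker_ft {y : ℝ} (hy : y ∈ Set.Ioo (0:ℝ) 1) (k : ℝ) :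
    ∫ x : ℝ, (Pker y x : ℂ) * cexp (-(I * k * x)) = gq y k := by
  have hpi := Real.pi_pos
  let f : ℝ → ℂ := fun v => (gq y (2 * π * v) : ℂ)
  have hfc : Continuous f := by
    have := gq_cont y
    fun_prop
  have hfi : Integrable f := ((gq_integrable hy).comp_mul_left' (by positivity : 2 * π ≠ 0)).ofReal
  have hF : FourierTransform.fourier f = fun x => (Pker y x : ℂ) := by
    ext x
    rw [Real.fourier_real_eq_integral_exp_smul]
    have h := Measure.integral_comp_mul_left (fun k : ℝ => (gq y k : ℂ) * cexp (-(I * k * x))) (2 * π)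
    rw [gq_full hy, abs_of_pos (by positivity)] at h
    have e : ((2 * π)⁻¹ : ℝ) • (2 * π * Pker y x : ℂ) = Pker y x := by
      rw [Complex.real_smul]; push_cast; field_simp
    rw [e] at h
    rw [← h]
    congr 1; ext v
    simp only [f, smul_eq_mul]
    rw [mul_comm]; congr 2; push_cast; ring
  have hinv := congrFun (hfc.fourierInv_fourier_eq hfi (by rw [hF]; exact (Pker_integrable hy).ofReal)) (-(k / (2 * π)))
  rw [hF, Real.fourierInv_eq'] at hinv
  have e : f (-(k / (2 * π))) = gq y k := by
    simp only [f]
    rw [mul_neg, mul_div_cancel₀ _ (by positivity), gq_neg]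
  rw [← e, ← hinv]
  congr 1; ext x
  rw [smul_eq_mul, mul_comm]; congr 2
  simp
  field_simp

/-- **Fourier transform of the Poisson kernel** (Lemma B.2). -/
theorem poisson_fourier (y : ℝ) (hy : y ∈ Set.Ioo (0:ℝ) 1) :
    (∀ k : ℝ, k ≠ 0 →
      (∫ x : ℝ, (Pker y x : ℂ) * Complex.exp (-(Complex.I * k * x))) =
        ((Real.sinh ((1 - y) * k) / Real.sinh k : ℝ) : ℂ)) ∧
    (∫ x : ℝ, Pker y x) = 1 - y ∧
    (∀ x : ℝ, 0 < Pker y x) ∧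
    eLpNorm (Pker y) 1 volume = ENNReal.ofReal (1 - y) := by
  have h2 : (∫ x : ℝ, Pker y x) = 1 - y := by
    have h := Pker_ft hy 0
    simp only [ofReal_zero, mul_zero, zero_mul, neg_zero, Complex.exp_zero, mul_one, gq_zero] at h
    rw [integral_complex_ofReal] at h
    exact_mod_cast h
  refine ⟨fun k hk => by rw [Pker_ft hy, gq_of_ne _ hk], h2, Pker_pos' hy, ?_⟩
  rw [eLpNorm_one_eq_lintegral_enorm, ← h2, ofReal_integral_eq_lintegral_ofReal (Pker_integrable hy)
    (Eventually.of_forall fun x => (Pker_pos' hy x).le)]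
  congr 1; ext x
  rw [Real.enorm_eq_ofReal (Pker_pos' hy x).le]
end
end
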